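/- arXiv:2004.00192 — 7 statements merged into one kernel-verified Lean document; each statement's English description precedes it below -/
import Mathlib

section
/- Let K = {f ∈ ℝ^n : A f ≤ b} (componentwise) for some A ∈ ℝ^{N×n} and b ∈ ℝ^N, let E = {e ∈ ℝ^m : ‖e‖_∞ ≤ η} with η > 0, let L : ℝ^n → ℝ^m be the linear observation operator with rows ℓ_1,…,ℓ_m, and let Q : ℝ^n → ℓ_∞^K be the linear map Q(f) = (⟨q_1,f⟩,…,⟨q_K,f⟩) for given q_1,…,q_K ∈ ℝ^n. Fix y ∈ ℝ^m and define à ∈ ℝ^{(N+2m)×n} by stacking A, L, and −L, and b̃ ∈ ℝ^{N+2m} by stacking b, y+η·1, and −y+η·1. Assume the set K_E(y) = {f ∈ ℝ^n : Ãf ≤ b̃} is nonempty and bounded. Then the linear program: minimize r over z ∈ ℝ^K, r ∈ ℝ, and x^{+,1},…,x^{+,K}, x^{−,1},…,x^{−,K} ∈ ℝ^{N+2m} subject to Ã^T x^{±,k} = ±q_k, x^{±,k} ≥ 0, and ⟨b̃, x^{±,k}⟩ ≤ r ± z_k for all k ∈ [1:K], has optimal value equal to the Chebyshev radius of Q(K_E(y))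 in ℓ_∞^K, and the z-component of any minimizer is a Chebyshev center of Q(K_E(y)). -/
open Matrix

/-- **Farkas' lemma** over a linearly ordered field, with no assumption on the dimension: a linear
form that is nonpositive wherever finitely many forms are nonpositive is a conic combination of
them. -/
theorem exists_nonneg_sum_eq_of_forall_nonpos {𝕜 V ι : Type*} [Field 𝕜] [LinearOrder 𝕜]
    [IsStrictOrderedRing 𝕜] [AddCommGroup V] [Module 𝕜 V] (s : Finset ι)
    (a : ι → Module.Dual 𝕜 V) (c : Module.Dual 𝕜 V)
    (h : ∀ x, (∀ i ∈ s, a i x ≤ 0) → c x ≤ 0) :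
    ∃ w : ι → 𝕜, (∀ i, 0 ≤ w i) ∧ c = ∑ i ∈ s, w i • a i := by
  classical
  induction s using Finset.induction_on generalizing a c with
  | empty =>
    refine ⟨0, fun _ => le_rfl, LinearMap.ext fun x => ?_⟩
    have h₁ := h x (by simp)
    have h₂ := h (-x) (by simp)
    rw [map_neg] at h₂
    simpa using le_antisymm h₁ (by linarith)
  | insert p s hp ih =>
    by_cases hc : ∀ x, (∀ i ∈ s, a i x ≤ 0) → c x ≤ 0
    · obtain ⟨w, hw, rfl⟩ := ih a c hc
      refine ⟨Function.update w p 0, fun i => ?_, ?_⟩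
      · by_cases hi : i = p
        · simp [hi]
        · simpa [hi] using hw i
      · rw [Finset.sum_insert hp]
        simp only [Function.update_self, zero_smul, zero_add]
        refine Finset.sum_congr rfl fun i hi => ?_
        rw [Function.update_of_ne (ne_of_mem_of_not_mem hi hp)]
    · push Not at hc
      obtain ⟨v, hv, hcv⟩ := hc
      have hpv : 0 < a p v := by
        by_contra hpv
        refine absurd (h v fun i hi => ?_) (not_le.2 hcv)
        rcases Finset.mem_insert.1 hi with rfl | hi
        · exact not_lt.1 hpv
        · exact hv i hi
      -- project along `v` onto the kernel of `a p`
      obtain ⟨w, hw, hsum⟩ := ih (fun i => a i - (a i v / a p v) • a p)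
        (c - (c v / a p v) • a p) (by
          intro x hx
          have := h (x - (a p x / a p v) • v) (by
            intro i hi
            rcases Finset.mem_insert.1 hi with rfl | hi
            · simp [hpv.ne']
            · have := hx i hi
              simp only [LinearMap.sub_apply, LinearMap.smul_apply, smul_eq_mul, map_sub,
                map_smul] at this ⊢
              calc _ = _ := by ring
                _ ≤ 0 := this)
          simp only [LinearMap.sub_apply, LinearMap.smul_apply, smul_eq_mul, map_sub,
            map_smul] at this ⊢
          calc _ = _ := by ring
            _ ≤ 0 := this)
      refine ⟨Function.update w p (c v / a p v - ∑ i ∈ s, w i * (a i v / a p v)),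
        fun i => ?_, ?_⟩
      · by_cases hi : i = p
        · subst hi
          rw [Function.update_self, sub_nonneg]
          refine (Finset.sum_nonpos fun j hj => ?_).trans (div_pos hcv hpv).le
          exact mul_nonpos_of_nonneg_of_nonpos (hw j)
            (div_nonpos_of_nonpos_of_nonneg (hv j hj) hpv.le)
        · simpa [hi] using hw i
      · have hupd : ∑ i ∈ s, Function.update w p
            (c v / a p v - ∑ i ∈ s, w i * (a i v / a p v)) i • a i = ∑ i ∈ s, w i • a i :=
          Finset.sum_congr rfl fun i hi => by
            rw [Function.update_of_ne (ne_of_mem_of_not_mem hi hp)]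
        rw [Finset.sum_insert hp, hupd, Function.update_self]
        ext x
        have hx := LinearMap.congr_fun hsum x
        simp only [LinearMap.sub_apply, LinearMap.add_apply, LinearMap.smul_apply,
          LinearMap.sum_apply, smul_eq_mul, mul_sub, Finset.sum_sub_distrib, sub_mul,
          Finset.sum_mul, mul_assoc] at hx ⊢
        linarith

/-- Affine form of Farkas' lemma: an affine inequality valid on a nonempty polyhedron is a
nonnegative combination of the defining inequalities. -/
theorem exists_nonneg_transpose_mulVec_eq {ι κ : Type*} [Fintype ι] [Fintype κ]
    (M : Matrix ι κ ℝ) (b : ι → ℝ) (q : κ → ℝ) (d : ℝ)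
    (hne : ∃ f, M *ᵥ f ≤ b) (h : ∀ f, M *ᵥ f ≤ b → q ⬝ᵥ f ≤ d) :
    ∃ x : ι → ℝ, Mᵀ *ᵥ x = q ∧ 0 ≤ x ∧ b ⬝ᵥ x ≤ d := by
  classical
  -- homogenize: `a i (f, t) = (M f) i - t b i` together with `- t`
  let form (u : κ → ℝ) (β : ℝ) : Module.Dual ℝ ((κ → ℝ) × ℝ) :=
    (dotProductBilin ℝ ℝ u).comp (LinearMap.fst ℝ _ _) - β • LinearMap.snd ℝ _ _
  have form_apply (u : κ → ℝ) (β : ℝ) (f : κ → ℝ) (t : ℝ) :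
      form u β (f, t) = u ⬝ᵥ f - β * t := by
    simp [form]
  obtain ⟨w, hw, hsum⟩ := exists_nonneg_sum_eq_of_forall_nonpos Finset.univ
    (fun o : Option ι => o.elim (form 0 1) fun i => form (M i) (b i)) (form q d) (by
      rintro ⟨f, t⟩ hx
      have ht : 0 ≤ t := by
        have := hx none (Finset.mem_univ _)
        simp only [Option.elim, form_apply, zero_dotProduct] at this
        linarith
      have hf : ∀ i, M i ⬝ᵥ f ≤ b i * t := fun i => by
        have := hx (some i) (Finset.mem_univ _)
        simp only [Option.elim, form_apply] at this
        linarith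
      rw [form_apply, sub_nonpos]
      rcases ht.eq_or_lt with rfl | ht
      · obtain ⟨g, hg⟩ := hne
        by_contra hlt
        simp only [mul_zero, not_le] at hlt hf
        obtain ⟨k, hk⟩ := exists_nat_gt ((d - q ⬝ᵥ g) / (q ⬝ᵥ f))
        have := h (g + (k : ℝ) • f) fun i => by
          have h₁ := hg i
          have h₂ := mul_nonpos_of_nonneg_of_nonpos k.cast_nonneg (hf i)
          change M i ⬝ᵥ _ ≤ _
          change M i ⬝ᵥ _ ≤ _ at h₁
          rw [dotProduct_add, dotProduct_smul, smul_eq_mul]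
          linarith
        rw [div_lt_iff₀ hlt] at hk
        rw [dotProduct_add, dotProduct_smul, smul_eq_mul] at this
        linarith
      · have := h (t⁻¹ • f) fun i => by
          change M i ⬝ᵥ _ ≤ _
          rw [dotProduct_smul, smul_eq_mul, inv_mul_le_iff₀ ht, mul_comm]
          exact hf i
        rw [dotProduct_smul, smul_eq_mul, inv_mul_le_iff₀ ht] at this
        linarith)
  have key (f : κ → ℝ) (t : ℝ) :
      q ⬝ᵥ f - d * t = w none * -t + ∑ i, w (some i) * (M i ⬝ᵥ f - b i * t) := by
    have := LinearMap.congr_fun hsum (f, t)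
    simpa [Fintype.sum_option, LinearMap.sum_apply, form_apply] using this
  refine ⟨fun i => w (some i), funext fun j => ?_, fun i => hw _, ?_⟩
  · have := key (Pi.single j 1) 0
    simp only [dotProduct_single, mul_one, mul_zero, sub_zero, neg_zero, zero_add] at this
    rw [this]
    simp [mulVec, dotProduct, mul_comm]
  · have := key 0 1
    simp only [dotProduct_zero, mul_one, zero_sub, mul_neg, Finset.sum_neg_distrib] at this
    have h₀ := hw none
    have hb : b ⬝ᵥ (fun i => w (some i)) = ∑ i, w (some i) * b i := by
      simp [dotProduct, mul_comm]
    linarith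

/-- Weak duality: a nonnegative combination of the defining inequalities is valid on a
polyhedron. -/
theorem dotProduct_le_of_transpose_mulVec_eq {ι κ : Type*} [Fintype ι] [Fintype κ]
    {M : Matrix ι κ ℝ} {b x : ι → ℝ} {q f : κ → ℝ} (hx : Mᵀ *ᵥ x = q) (hx₀ : 0 ≤ x)
    (hf : M *ᵥ f ≤ b) : q ⬝ᵥ f ≤ b ⬝ᵥ x := by
  rw [← hx, mulVec_transpose, ← dotProduct_mulVec, dotProduct_comm b]
  exact dotProduct_le_dotProduct_of_nonneg_left hf hx₀

/-- Local optimality under a polytope model: the linear program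
computes the Chebyshev radius of `Q(K_E(y))` in `ℓ_∞^K`, and the `z`-component of any
minimizer is a Chebyshev center of `Q(K_E(y))`. -/
theorem lp_computes_chebyshev_center_polytope_model
    (n N m K : ℕ)
    (A : Matrix (Fin N) (Fin n) ℝ) (b : Fin N → ℝ)
    (L : Matrix (Fin m) (Fin n) ℝ)
    (q : Fin K → Fin n → ℝ)
    (η : ℝ) (hη : 0 < η) (y : Fin m → ℝ)
    -- the stacked matrix à and vector b̃
    (Atil : Matrix (Fin N ⊕ (Fin m ⊕ Fin m)) (Fin n) ℝ)
    (hAtil : Atil = Matrix.of (Sum.elim A (Sum.elim L (-L))))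
    (btil : (Fin N ⊕ (Fin m ⊕ Fin m)) → ℝ)
    (hbtil : btil = Sum.elim b (Sum.elim (fun i => y i + η) (fun i => -y i + η)))
    -- the constraint set K_E(y) = {f : à f ≤ b̃}, assumed nonempty and bounded
    (KE : Set (Fin n → ℝ))
    (hKE : KE = {f | Atil.mulVec f ≤ btil})
    (hne : KE.Nonempty) (hbd : Bornology.IsBounded KE)
    -- its image S = Q(K_E(y)) under the linear map Q(f) = (⟨q_1,f⟩,…,⟨q_K,f⟩) in ℓ_∞^K
    (S : Set (Fin K → ℝ)) (hS : S = (fun f => fun k => q k ⬝ᵥ f) '' KE)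
    -- the Chebyshev radius of S with respect to the sup norm on ℝ^K
    (rad : ℝ)
    (hrad : rad = sInf {r : ℝ | ∃ c : Fin K → ℝ, ∀ s ∈ S, ‖s - c‖ ≤ r})
    -- the values of the linear program
    (LPvals : Set ℝ)
    (hLP : LPvals = {r : ℝ |
      ∃ (z : Fin K → ℝ) (xp xm : Fin K → (Fin N ⊕ (Fin m ⊕ Fin m)) → ℝ),
      ∀ k : Fin K,
        Atil.transpose.mulVec (xp k) = q k ∧
        Atil.transpose.mulVec (xm k) = -(q k) ∧
        0 ≤ xp k ∧ 0 ≤ xm k ∧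
        btil ⬝ᵥ xp k ≤ r + z k ∧ btil ⬝ᵥ xm k ≤ r - z k}) :
    -- conclusion: the optimal LP value is the Chebyshev radius, and the z-component
    -- of any minimizer is a Chebyshev center of S
    sInf LPvals = rad ∧
    ∀ (z : Fin K → ℝ) (r : ℝ) (xp xm : Fin K → (Fin N ⊕ (Fin m ⊕ Fin m)) → ℝ),
      (∀ k : Fin K,
        Atil.transpose.mulVec (xp k) = q k ∧
        Atil.transpose.mulVec (xm k) = -(q k) ∧
        0 ≤ xp k ∧ 0 ≤ xm k ∧
        btil ⬝ᵥ xp k ≤ r + z k ∧ btil ⬝ᵥ xm k ≤ r - z k) →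
      r = sInf LPvals →
      ∀ s ∈ S, ‖s - z‖ ≤ rad := by
  subst hS hrad hLP
  have weak : ∀ (z : Fin K → ℝ) (r : ℝ) (xp xm : Fin K → (Fin N ⊕ (Fin m ⊕ Fin m)) → ℝ),
      (∀ k : Fin K, Atilᵀ *ᵥ xp k = q k ∧ Atilᵀ *ᵥ xm k = -(q k) ∧ 0 ≤ xp k ∧ 0 ≤ xm k ∧
        btil ⬝ᵥ xp k ≤ r + z k ∧ btil ⬝ᵥ xm k ≤ r - z k) →
      ∀ f ∈ KE, ∀ k, |q k ⬝ᵥ f - z k| ≤ r := by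
    intro z r xp xm hx f hf k
    rw [hKE] at hf
    obtain ⟨hp, hm, hp₀, hm₀, hpr, hmr⟩ := hx k
    have h₁ := dotProduct_le_of_transpose_mulVec_eq hp hp₀ hf
    have h₂ := dotProduct_le_of_transpose_mulVec_eq hm hm₀ hf
    rw [neg_dotProduct] at h₂
    exact abs_le.2 ⟨by linarith, by linarith⟩
  rcases Nat.eq_zero_or_pos K with rfl | hK
  · -- with no quantity of interest both programs have value `0`
    obtain ⟨f, hf⟩ := hne
    have hrad : {r : ℝ | ∃ c : Fin 0 → ℝ,
        ∀ s ∈ (fun f => fun k => q k ⬝ᵥ f) '' KE, ‖s - c‖ ≤ r} = Set.Ici 0 := by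
      ext r
      refine ⟨fun ⟨c, hc⟩ => (norm_nonneg _).trans (hc _ ⟨f, hf, rfl⟩), fun hr => ⟨0, ?_⟩⟩
      intro s _
      rw [Subsingleton.elim (s - 0) 0, norm_zero]
      exact hr
    rw [hrad, csInf_Ici]
    refine ⟨by simp, fun z r xp xm _ _ s _ => ?_⟩
    rw [Subsingleton.elim (s - z) 0, norm_zero]
  · have : Nonempty (Fin K) := ⟨⟨0, hK⟩⟩
    have norm_le_iff (f : Fin n → ℝ) (z : Fin K → ℝ) (r : ℝ) :
        ‖(fun k => q k ⬝ᵥ f) - z‖ ≤ r ↔ ∀ k, |q k ⬝ᵥ f - z k| ≤ r :=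
      pi_norm_le_iff_of_nonempty _
    have hvals : {r : ℝ | ∃ (z : Fin K → ℝ) (xp xm : Fin K → (Fin N ⊕ (Fin m ⊕ Fin m)) → ℝ),
        ∀ k : Fin K, Atilᵀ *ᵥ xp k = q k ∧ Atilᵀ *ᵥ xm k = -(q k) ∧ 0 ≤ xp k ∧ 0 ≤ xm k ∧
          btil ⬝ᵥ xp k ≤ r + z k ∧ btil ⬝ᵥ xm k ≤ r - z k} =
        {r : ℝ | ∃ c : Fin K → ℝ,
          ∀ s ∈ (fun f => fun k => q k ⬝ᵥ f) '' KE, ‖s - c‖ ≤ r} := by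
      ext r
      constructor
      · rintro ⟨z, xp, xm, hx⟩
        refine ⟨z, ?_⟩
        rintro _ ⟨f, hf, rfl⟩
        exact (norm_le_iff f z r).2 (weak z r xp xm hx f hf)
      · rintro ⟨c, hc⟩
        have hc' (f : Fin n → ℝ) (hf : Atil *ᵥ f ≤ btil) (k : Fin K) :=
          abs_le.1 ((norm_le_iff f c r).1 (hc _ ⟨f, by rw [hKE]; exact hf, rfl⟩) k)
        rw [hKE] at hne
        choose xp hxp using fun k => exists_nonneg_transpose_mulVec_eq Atil btil (q k) (r + c k)
          hne fun f hf => by linarith [(hc' f hf k).2]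
        choose xm hxm using fun k => exists_nonneg_transpose_mulVec_eq Atil btil (-(q k))
          (r - c k) hne fun f hf => by rw [neg_dotProduct]; linarith [(hc' f hf k).1]
        exact ⟨c, xp, xm, fun k => ⟨(hxp k).1, (hxm k).1, (hxp k).2.1, (hxm k).2.1,
          (hxp k).2.2, (hxm k).2.2⟩⟩
    refine ⟨congrArg sInf hvals, ?_⟩
    rintro z r xp xm hx hr _ ⟨f, hf, rfl⟩
    rw [← hvals, ← hr]
    exact (norm_le_iff f z r).2 (weak z r xp xm hx f hf)
end

section
/- Let P_n denote the space of real algebraic polynomials of degree < n equipped with the supremum norm on [−1,1], let K = {f ∈ P_n : ‖f‖_{C[−1,1]} ≤ 1}, and let E = {e ∈ ℝ^m : ‖e‖_∞ ≤ η} with η > 0. Let ℓ_1,…,ℓ_m and Q_1,…,Q_K be linear functionals on P_n, let L(f) = (ℓ_1(f),…,ℓ_m(f)), Q(f) = (Q_1(f),…,Q_K(f)) ∈ ℓ_∞^K, and define C_k = Toep_n(Q_k(T_0),…,Q_k(T_{n−1})) and A_i = Toep_n(ℓ_i(T_0),…,ℓ_i(T_{n−1})), where T_j is the j-th Chebyshev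 polynomial of the first kind. Fix y ∈ L(K) + E. Then the semidefinite program: minimize r over z ∈ ℝ^K, r ∈ ℝ, and (for each k ∈ [1:K] and each sign ±) x^{±,k} ∈ ℝ^n, u^{±,k}, v^{±,k} ∈ ℝ^m, subject to x_1^{±,k} + ⟨u^{±,k}, y+η·1⟩ − ⟨v^{±,k}, y−η·1⟩ ≤ r ± z_k, u^{±,k} ≥ 0, v^{±,k} ≥ 0, Toep_n(x^{±,k}) ⪰ +(±C_k + Σ_{i=1}^m (v_i^{±,k} − u_i^{±,k}) A_i), and Toep_n(x^{±,k}) ⪰ −(±C_k + Σ_{i=1}^m (v_i^{±,k} − u_i^{±,k}) A_i), has optimal value equal to the Chebyshev radius of Q(K_E(y)) in ℓ_∞^K, and the z-component of any minimizer is a Chebyshev center of Q(K_E(y)); here K_E(y) = {f ∈ K : ‖L(f) − y‖_∞ ≤ η}. -/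
open Matrix Polynomial

/-- The symmetric Toeplitz matrix built from a vector `z`, with entries
`(Toep z) j k = z_{|j-k|}` (0-indexed). -/
noncomputable def Toep {N : ℕ} (z : Fin N → ℝ) : Matrix (Fin N) (Fin N) ℝ :=
  Matrix.of fun j k => z ⟨Nat.dist j.1 k.1, by
    have hj := j.isLt; have hk := k.isLt; simp only [Nat.dist]; omega⟩

open Polynomial.Chebyshev in
theorem T_natDist (j k : ℕ) : T ℝ ((Nat.dist j k : ℕ) : ℤ) = T ℝ ((j : ℤ) - k) := by
  rw [← T_natAbs ℝ ((j : ℤ) - k)]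
  congr 2
  simp only [Nat.dist]
  omega

theorem Toep_apply {N : ℕ} (F : ℕ → ℝ) (j k : Fin N) :
    Toep (fun i : Fin N => F i) j k = F (Nat.dist j k) := rfl

theorem Toep_isHermitian {N : ℕ} (w : Fin N → ℝ) : (Toep w).IsHermitian := by
  ext j k
  simp [Toep, Nat.dist_comm]

theorem Toep_posSemidef_iff {N : ℕ} (w : Fin N → ℝ) :
    (Toep w).PosSemidef ↔ ∀ c : Fin N → ℝ, 0 ≤ ∑ j, ∑ k, c j * c k * Toep w j k := by
  rw [posSemidef_iff_dotProduct_mulVec]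
  refine ⟨fun h c => (h.2 c).trans_eq ?_, fun h => ⟨Toep_isHermitian w, fun c => (h c).trans_eq ?_⟩⟩
  all_goals
    simp only [dotProduct, mulVec, Finset.mul_sum, star_trivial]
    exact Finset.sum_congr rfl fun j _ => Finset.sum_congr rfl fun k _ => by ring

theorem sum_sum_mul_cos_sub {N : ℕ} (c : Fin N → ℝ) (θ : ℝ) :
    ∑ j, ∑ k, c j * c k * Real.cos (((j : ℕ) - (k : ℕ) : ℝ) * θ) =
      (∑ j, c j * Real.cos ((j : ℕ) * θ)) ^ 2 + (∑ j, c j * Real.sin ((j : ℕ) * θ)) ^ 2 := by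
  simp only [sq, Finset.sum_mul_sum, ← Finset.sum_add_distrib]
  refine Finset.sum_congr rfl fun j _ => Finset.sum_congr rfl fun k _ => ?_
  rw [sub_mul, Real.cos_sub]
  ring

theorem eval_T_natDist_cos (j k : ℕ) (θ : ℝ) :
    (Chebyshev.T ℝ ((Nat.dist j k : ℕ) : ℤ)).eval (Real.cos θ) =
      Real.cos (((j : ℝ) - k) * θ) := by
  rw [T_natDist, Chebyshev.T_real_cos]
  push_cast
  rfl

/-- Moments of a point mass form a positive semidefinite Toeplitz matrix. -/
theorem Toep_eval_T_posSemidef {N : ℕ} {t : ℝ} (ht : t ∈ Set.Icc (-1 : ℝ) 1) :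
    (Toep fun j : Fin N => (Chebyshev.T ℝ ((j : ℕ) : ℤ)).eval t).PosSemidef := by
  rw [Toep_posSemidef_iff]
  intro c
  rw [← Real.cos_arccos ht.1 ht.2]
  simp only [Toep_apply fun i => (Chebyshev.T ℝ (i : ℤ)).eval (Real.cos (Real.arccos t)),
    eval_T_natDist_cos]
  rw [sum_sum_mul_cos_sub]
  positivity

theorem abs_le_of_Toep_posSemidef {N : ℕ} (hN : 0 < N) {w : Fin N → ℝ}
    (hw : (Toep w).PosSemidef) (j : Fin N) : |w j| ≤ w ⟨0, hN⟩ := by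
  have h0 : ∀ i, Toep w i i = w ⟨0, hN⟩ := fun i => by simp [Toep]
  have h1 : Toep w ⟨0, hN⟩ j = w j := by simp [Toep, Nat.dist]
  have h2 : Toep w j ⟨0, hN⟩ = w j := by simp [Toep, Nat.dist]
  have key : ∀ s : ℝ, 0 ≤ w ⟨0, hN⟩ + 2 * s * w j + s ^ 2 * w ⟨0, hN⟩ := fun s => by
    refine (hw.dotProduct_mulVec_nonneg (Pi.single ⟨0, hN⟩ 1 + s • Pi.single j 1)).trans_eq ?_
    simp only [star_trivial, mulVec_add, mulVec_smul, mulVec_single_one, add_dotProduct,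
      dotProduct_add, smul_dotProduct, dotProduct_smul, single_one_dotProduct, col_apply,
      smul_eq_mul, h0, h1, h2]
    ring
  have := key 1
  have := key (-1)
  rw [abs_le]
  constructor <;> linarith

/-- A polynomial that is positive on `[-1, 1]` is, after substituting `cos θ`, the squared modulus
of a real polynomial at `exp (i θ)` (Fejér–Riesz for cosine polynomials). -/
theorem exists_norm_sq_aeval_eq (g : ℝ[X]) (hg : ∀ x ∈ Set.Icc (-1 : ℝ) 1, 0 < g.eval x) :
    ∃ p : ℝ[X], p.natDegree ≤ g.natDegree ∧
      ∀ θ : ℝ, ‖aeval (Complex.exp (θ * Complex.I)) p‖ ^ 2 = g.eval (Real.cos θ) := by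
  induction hd : g.natDegree using Nat.strong_induction_on generalizing g with
  | h d ih =>
  have g_ne : g ≠ 0 := by
    rintro rfl
    simpa using hg 0 (by simp)
  -- a positive factor which is itself a squared modulus can be split off
  have split : ∀ q h q' : ℝ[X], g = q * h → 0 < q.natDegree → q'.natDegree ≤ q.natDegree →
      (∀ x ∈ Set.Icc (-1 : ℝ) 1, 0 < q.eval x) →
      (∀ θ : ℝ, ‖aeval (Complex.exp (θ * Complex.I)) q'‖ ^ 2 = q.eval (Real.cos θ)) →
      ∃ p : ℝ[X], p.natDegree ≤ d ∧
        ∀ θ : ℝ, ‖aeval (Complex.exp (θ * Complex.I)) p‖ ^ 2 = g.eval (Real.cos θ) := by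
    intro q h q' hgq hq0 hq' hqpos hq
    have hqh : q ≠ 0 ∧ h ≠ 0 := by
      rw [hgq] at g_ne
      exact mul_ne_zero_iff.1 g_ne
    have hdeg : d = q.natDegree + h.natDegree := by
      rw [← hd, hgq, natDegree_mul hqh.1 hqh.2]
    have hpos : ∀ x ∈ Set.Icc (-1 : ℝ) 1, 0 < h.eval x := fun x hx => by
      have := hg x hx
      rw [hgq, eval_mul] at this
      exact (pos_iff_pos_of_mul_pos this).1 (hqpos x hx)
    obtain ⟨p, hp, hpe⟩ := ih h.natDegree (by omega) h hpos rfl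
    refine ⟨q' * p, natDegree_mul_le.trans (by omega), fun θ => ?_⟩
    rw [map_mul, norm_mul, mul_pow, hq, hpe, hgq, eval_mul]
  rcases Nat.eq_zero_or_pos d with h0 | h0
  · have hc := eq_C_of_natDegree_eq_zero (hd.trans h0)
    have hpos : 0 < g.coeff 0 := by
      have := hg 0 (by simp)
      rwa [hc, eval_C] at this
    refine ⟨C √(g.coeff 0), by simp, fun θ => ?_⟩
    rw [hc]
    simp [abs_of_nonneg, Real.sq_sqrt hpos.le]
  obtain ⟨w, hw⟩ : ∃ w : ℂ, aeval w g = 0 := by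
    refine IsAlgClosed.exists_aeval_eq_zero ℂ g ?_
    exact (natDegree_pos_iff_degree_pos.1 (by omega)).ne'
  by_cases him : w.im = 0
  · -- a real root lies outside `[-1, 1]`
    obtain ⟨a, rfl⟩ : ∃ a : ℝ, (a : ℂ) = w := ⟨w.re, Complex.ext rfl (by simp [him])⟩
    have hroot : g.eval a = 0 := by
      have : aeval ((algebraMap ℝ ℂ) a) g = 0 := hw
      rw [aeval_algebraMap_apply] at this
      simpa using this
    have ha : a ∉ Set.Icc (-1 : ℝ) 1 := fun h => (hg a h).ne' hroot
    have ha1 : 1 < a ^ 2 := by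
      by_contra hcon
      exact ha (abs_le.1 (abs_le_one_iff_mul_self_le_one.2 (by nlinarith)))
    obtain ⟨h, hh⟩ := dvd_iff_isRoot.2 hroot
    set D := √(a ^ 2 - 1)
    have hD : D ^ 2 = a ^ 2 - 1 := Real.sq_sqrt (by linarith)
    have hD0 : 0 ≤ D := Real.sqrt_nonneg _
    -- both signs of `a` at once, with `s = sign a`
    obtain ⟨s, hs, hsa⟩ : ∃ s : ℝ, s ^ 2 = 1 ∧ 1 < s * a := by
      rcases le_total 0 a with h | h
      · exact ⟨1, by norm_num, by nlinarith⟩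
      · exact ⟨-1, by norm_num, by nlinarith⟩
    have hs' : |s| = 1 := by
      rw [← abs_one, ← sq_eq_sq_iff_abs_eq_abs, hs, one_pow]
    have hs0 : s ≠ 0 := by rintro rfl; norm_num at hs
    have hζ : 0 < 2 * (s * a + D) := by linarith
    refine split (C (-s) * (X - C a)) (C (-s) * h) (C (√(2 * (s * a + D)))⁻¹ * (X - C (a + s * D)))
      ?_ ?_ ?_ ?_ ?_
    · rw [hh]
      have : (C (-s) * C (-s) : ℝ[X]) = 1 := by
        rw [← C_mul, neg_mul_neg, ← sq, hs, C_1]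
      linear_combination (-(X - C a) * h) * this
    · rw [natDegree_C_mul (neg_ne_zero.2 hs0), natDegree_X_sub_C]
      norm_num
    · rw [natDegree_C_mul (neg_ne_zero.2 hs0), natDegree_X_sub_C]
      exact (natDegree_C_mul_le _ _).trans (natDegree_X_sub_C_le _)
    · intro x hx
      have hsx : s * x ≤ 1 := by
        refine (le_abs_self _).trans ?_
        rw [abs_mul, hs', one_mul]
        exact abs_le.2 hx
      simp only [eval_mul, eval_C, eval_sub, eval_X]
      nlinarith
    · intro θ
      rw [← Complex.normSq_eq_norm_sq]
      have hsc := Real.sin_sq_add_cos_sq θ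
      simp only [map_mul, map_sub, aeval_X, aeval_C, eval_mul, eval_C, eval_sub, eval_X,
        Complex.coe_algebraMap, Complex.normSq_apply, Complex.sub_re,
        Complex.sub_im, Complex.exp_ofReal_mul_I_re, Complex.exp_ofReal_mul_I_im,
        Complex.ofReal_re, Complex.ofReal_im, mul_zero, add_zero, sub_zero]
      rw [← mul_inv, Real.mul_self_sqrt hζ.le, inv_mul_eq_iff_eq_mul₀ hζ.ne']
      linear_combination hsc + hD + (D ^ 2 + 2 * a * Real.cos θ - 2 * a ^ 2) * hs
  · obtain ⟨D, hD⟩ : ∃ D : ℂ, D ^ 2 = w ^ 2 - 1 := IsAlgClosed.exists_pow_nat_eq _ (by norm_num)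
    obtain ⟨h, hh⟩ := g.quadratic_dvd_of_aeval_eq_zero_im_ne_zero hw him
    set ζ := w + D
    have hζ : ζ ^ 2 + 1 = 2 * w * ζ := by simp only [ζ]; linear_combination hD
    have hζ0 : ζ ≠ 0 := by
      intro h
      rw [h] at hζ
      norm_num at hζ
    have hζn : 0 < ‖ζ‖ := norm_pos_iff.2 hζ0
    have quad_eval : ∀ x : ℝ, (X ^ 2 - C (2 * w.re) * X + C (‖w‖ ^ 2)).eval x =
        ‖(x : ℂ) - w‖ ^ 2 := fun x => by
      rw [← Complex.normSq_eq_norm_sq, ← Complex.normSq_eq_norm_sq]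
      simp [Complex.normSq_apply]
      ring
    have quad_deg : ∀ b c : ℝ, (X ^ 2 - C b * X + C c : ℝ[X]).natDegree = 2 := fun b c => by
      compute_degree!
    refine split _ h (C (2 * ‖ζ‖)⁻¹ * (X ^ 2 - C (2 * ζ.re) * X + C (‖ζ‖ ^ 2))) hh ?_ ?_ ?_ ?_
    · rw [quad_deg]; norm_num
    · refine (natDegree_C_mul_le _ _).trans ?_
      rw [quad_deg, quad_deg]
    · intro x _
      rw [quad_eval]
      refine pow_pos (norm_pos_iff.2 fun h0 => him ?_) 2
      have := congrArg Complex.im h0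
      simpa using this
    · intro θ
      rw [quad_eval]
      set e := Complex.exp (θ * Complex.I)
      have he : starRingEnd ℂ e * e = 1 := by
        rw [← Complex.normSq_eq_conj_mul_self, Complex.normSq_eq_norm_sq,
          Complex.norm_exp_ofReal_mul_I]
        norm_num
      have hcos : e + starRingEnd ℂ e = 2 * ((Real.cos θ : ℝ) : ℂ) := by
        rw [Complex.add_conj, Complex.exp_ofReal_mul_I_re]
        push_cast
        rfl
      have hfac : aeval e (C (2 * ‖ζ‖)⁻¹ * (X ^ 2 - C (2 * ζ.re) * X + C (‖ζ‖ ^ 2))) =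
          ((2 * ‖ζ‖)⁻¹ : ℝ) * ((e - ζ) * (e - starRingEnd ℂ ζ)) := by
        have h1 : ζ + starRingEnd ℂ ζ = (2 * ζ.re : ℝ) := Complex.add_conj ζ
        have h2 : starRingEnd ℂ ζ * ζ = ((‖ζ‖ ^ 2 : ℝ) : ℂ) := by
          rw [← Complex.normSq_eq_conj_mul_self, Complex.normSq_eq_norm_sq]
        simp only [map_mul, map_add, map_sub, map_pow, aeval_X, aeval_C, Complex.coe_algebraMap]
        congr 1
        push_cast at h1 h2 ⊢
        linear_combination e * h1 - h2
      have hconj : ‖e - starRingEnd ℂ ζ‖ = ‖starRingEnd ℂ e - ζ‖ := by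
        rw [← Complex.norm_conj, map_sub, Complex.conj_conj]
      have hprod : (e - ζ) * (starRingEnd ℂ e - ζ) = 2 * ζ * (w - (Real.cos θ : ℝ)) := by
        linear_combination he - ζ * hcos + hζ
      rw [hfac, norm_mul, norm_mul, hconj, ← norm_mul, hprod, norm_mul, norm_mul,
        norm_sub_rev w, Complex.norm_real, Real.norm_of_nonneg (by positivity), Complex.norm_ofNat]
      field_simp

/-- A functional whose Chebyshev moments form a positive semidefinite Toeplitz matrix is
nonnegative on polynomials that are positive on `[-1, 1]`. -/
theorem apply_nonneg_of_Toep_posSemidef {n : ℕ} (W : ℝ[X] →ₗ[ℝ] ℝ)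
    (hW : (Toep fun j : Fin n => W (Chebyshev.T ℝ ((j : ℕ) : ℤ))).PosSemidef)
    {g : ℝ[X]} (hgn : g ∈ degreeLT ℝ n) (hg : ∀ x ∈ Set.Icc (-1 : ℝ) 1, 0 < g.eval x) :
    0 ≤ W g := by
  obtain ⟨p, hp, hpe⟩ := exists_norm_sq_aeval_eq g hg
  have g_ne : g ≠ 0 := by
    rintro rfl
    simpa using hg 0 (by simp)
  have hpn : p.natDegree < n :=
    hp.trans_lt ((natDegree_lt_iff_degree_lt g_ne).2 (mem_degreeLT.1 hgn))
  have hgp : g = ∑ j : Fin n, ∑ k : Fin n,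
      (p.coeff j * p.coeff k) • Chebyshev.T ℝ ((Nat.dist j k : ℕ) : ℤ) := by
    refine eq_of_infinite_eval_eq _ _ ((Set.Icc_infinite (show (-1 : ℝ) < 1 by norm_num)).mono ?_)
    intro x hx
    rw [Set.mem_ofPred_eq, ← Real.cos_arccos hx.1 hx.2]
    set θ := Real.arccos x
    rw [← hpe θ]
    simp only [eval_finsetSum, eval_smul, smul_eq_mul, eval_T_natDist_cos]
    rw [sum_sum_mul_cos_sub (fun j : Fin n => p.coeff j), aeval_eq_sum_range' hpn,
      ← Fin.sum_univ_eq_sum_range fun i => p.coeff i • Complex.exp (θ * Complex.I) ^ i,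
      ← Complex.normSq_eq_norm_sq, Complex.normSq_apply, Complex.re_sum, Complex.im_sum]
    have hexp : ∀ i : ℕ, Complex.exp (θ * Complex.I) ^ i = Complex.exp ((i * θ : ℝ) * Complex.I) :=
      fun i => by
        rw [← Complex.exp_nat_mul]
        push_cast
        ring_nf
    simp only [hexp, Complex.smul_re, Complex.smul_im, Complex.exp_ofReal_mul_I_re,
      Complex.exp_ofReal_mul_I_im, smul_eq_mul, sq]
  rw [hgp]
  simp only [map_sum, map_smul, smul_eq_mul]
  exact (Toep_posSemidef_iff _).1 hW fun j => p.coeff j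

/-- Prescribing the first `n` Chebyshev moments of a linear functional. -/
theorem exists_linearMap_apply_T {n : ℕ} (x : Fin n → ℝ) :
    ∃ X : ℝ[X] →ₗ[ℝ] ℝ, ∀ j : Fin n, X (Chebyshev.T ℝ ((j : ℕ) : ℤ)) = x j := by
  let S : Polynomial.Sequence ℝ := ⟨fun i => Chebyshev.T ℝ (i : ℤ), fun i => by simp⟩
  have hS : ∀ i, IsUnit (S i).leadingCoeff := fun i => by
    simp [S]
  refine ⟨(S.basis hS).constr ℝ fun i => if h : i < n then x ⟨i, h⟩ else 0, fun j => ?_⟩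
  have : Chebyshev.T ℝ ((j : ℕ) : ℤ) = S.basis hS j := by simp [S]
  rw [this, Module.Basis.constr_basis]
  simp

theorem linearMap_pi_apply {N : ℕ} (φ : (Fin N → ℝ) →ₗ[ℝ] ℝ) (w : Fin N → ℝ) :
    φ w = ∑ j, w j * φ (Pi.single j 1) := by
  rw [φ.pi_apply_eq_sum_univ w]
  refine Finset.sum_congr rfl fun j _ => ?_
  rw [smul_eq_mul]
  congr 2
  ext k
  simp [Pi.single_apply, eq_comm]

theorem Toep_add {N : ℕ} (x w : Fin N → ℝ) : Toep (x + w) = Toep x + Toep w := rfl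

theorem Toep_sub {N : ℕ} (x w : Fin N → ℝ) : Toep (x - w) = Toep x - Toep w := rfl

theorem Toep_smul {N : ℕ} (a : ℝ) (x : Fin N → ℝ) : Toep (a • x) = a • Toep x := rfl

theorem isClosed_setOf_Toep_posSemidef (N : ℕ) :
    IsClosed {w : Fin N → ℝ | (Toep w).PosSemidef} := by
  simp only [Toep_posSemidef_iff, Set.ofPred_forall]
  refine isClosed_iInter fun c => isClosed_le continuous_const ?_
  exact continuous_finsetSum _ fun j _ => continuous_finsetSum _ fun k _ =>
    continuous_const.mul (continuous_apply _)

/-- The unit ball of the polynomials of degree `< n` for the sup norm on `[-1, 1]`. -/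
def polyBall (n : ℕ) : Set ℝ[X] :=
  {f | f ∈ degreeLT ℝ n ∧ ∀ x ∈ Set.Icc (-1 : ℝ) 1, |f.eval x| ≤ 1}

theorem convex_polyBall (n : ℕ) : Convex ℝ (polyBall n) := by
  intro f hf g hg a b ha hb hab
  refine ⟨add_mem (Submodule.smul_mem _ _ hf.1) (Submodule.smul_mem _ _ hg.1), fun x hx => ?_⟩
  rw [eval_add, eval_smul, eval_smul, smul_eq_mul, smul_eq_mul]
  calc |a * f.eval x + b * g.eval x| ≤ |a * f.eval x| + |b * g.eval x| := abs_add_le _ _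
    _ = a * |f.eval x| + b * |g.eval x| := by
      rw [abs_mul, abs_mul, abs_of_nonneg ha, abs_of_nonneg hb]
    _ ≤ a * 1 + b * 1 := by gcongr <;> [exact hf.2 x hx; exact hg.2 x hx]
    _ = 1 := by linarith

/-- The unit ball, seen through finitely many linear functionals, is compact. -/
theorem isCompact_image_polyBall {E : Type*} [NormedAddCommGroup E] [NormedSpace ℝ E] (n : ℕ)
    (Φ : ℝ[X] →ₗ[ℝ] E) : IsCompact (Φ '' polyBall n) := by
  let v : Fin n → ℝ := fun i => (i : ℝ) / n
  have hv : ∀ i, v i ∈ Set.Icc (-1 : ℝ) 1 := fun i => by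
    have hi : ((i : ℕ) : ℝ) ≤ n := by exact_mod_cast i.2.le
    exact ⟨by have : 0 ≤ v i := by positivity
              linarith, div_le_one_of_le₀ hi (by positivity)⟩
  have hinj : Set.InjOn v (Finset.univ : Finset (Fin n)) := by
    intro i _ j _ hij
    have hn : (n : ℝ) ≠ 0 := by exact_mod_cast (Fin.pos i).ne'
    have := (div_left_inj' hn).1 hij
    exact Fin.ext (by exact_mod_cast this)
  let I := Lagrange.interpolate Finset.univ v
  have himage : polyBall n = I '' (I ⁻¹' polyBall n) := by
    refine (Set.image_preimage_eq_of_subset fun f hf => ?_).symm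
    refine ⟨fun i => f.eval (v i), (Lagrange.eq_interpolate hinj ?_).symm⟩
    simpa using mem_degreeLT.1 hf.1
  have hpre : I ⁻¹' polyBall n = {a | ∀ x ∈ Set.Icc (-1 : ℝ) 1, |(I a).eval x| ≤ 1} := by
    ext a
    refine ⟨fun h => h.2, fun h => ⟨mem_degreeLT.2 ?_, h⟩⟩
    exact (Lagrange.degree_interpolate_lt a hinj).trans_eq (by simp)
  have hcompact : IsCompact (I ⁻¹' polyBall n) := by
    refine (isCompact_univ_pi fun _ : Fin n =>
      isCompact_Icc (a := (-1 : ℝ)) (b := 1)).of_isClosed_subset ?_ fun a ha i _ => ?_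
    · rw [hpre]
      simp only [Set.ofPred_forall]
      refine isClosed_biInter fun x _ => isClosed_le (continuous_abs.comp ?_) continuous_const
      exact ((leval x).comp I).continuous_of_finiteDimensional
    · have := ha.2 (v i) (hv i)
      rw [Lagrange.eval_interpolate_at_node a hinj (Finset.mem_univ i)] at this
      exact abs_le.1 this
  rw [himage, Set.image_image]
  exact hcompact.image (Φ.comp I).continuous_of_finiteDimensional

/-- The first `n` Chebyshev moments of a functional `Λ`. -/
noncomputable def moments (n : ℕ) (Λ : ℝ[X] →ₗ[ℝ] ℝ) : Fin n → ℝ :=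
  fun j => Λ (Chebyshev.T ℝ ((j : ℕ) : ℤ))

/-- If `Toep x` dominates the moment matrices of `Λ` and `-Λ`, then `x₁` bounds `Λ` on the unit
ball. -/
theorem apply_le_of_Toep_posSemidef {n : ℕ} (hn : 0 < n) {x : Fin n → ℝ} {Λ : ℝ[X] →ₗ[ℝ] ℝ}
    (hsub : (Toep (x - moments n Λ)).PosSemidef) (hadd : (Toep (x + moments n Λ)).PosSemidef)
    {f : ℝ[X]} (hf : f ∈ polyBall n) : Λ f ≤ x ⟨0, hn⟩ := by
  obtain ⟨Ξ, hΞ⟩ := exists_linearMap_apply_T x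
  have hΞ1 : Ξ 1 = x ⟨0, hn⟩ := by simpa using hΞ ⟨0, hn⟩
  have hx : x = moments n Ξ := funext fun j => (hΞ j).symm
  have hone : (1 : ℝ[X]) ∈ degreeLT ℝ n := by
    rw [mem_degreeLT, degree_one]
    exact_mod_cast hn
  have key : ∀ ε : ℝ, 0 < ε → Λ f ≤ (1 + ε) * x ⟨0, hn⟩ := fun ε hε => by
    have h1 : 0 ≤ (Ξ + Λ) ((1 + ε) • 1 - f) := by
      refine apply_nonneg_of_Toep_posSemidef (n := n) (Ξ + Λ) (by rw [hx] at hadd; exact hadd)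
        (sub_mem (Submodule.smul_mem _ _ hone) hf.1) fun t ht => ?_
      have := abs_le.1 (hf.2 t ht)
      simp only [eval_sub, eval_smul, eval_one, smul_eq_mul]
      linarith
    have h2 : 0 ≤ (Ξ - Λ) ((1 + ε) • 1 + f) := by
      refine apply_nonneg_of_Toep_posSemidef (n := n) (Ξ - Λ) (by rw [hx] at hsub; exact hsub)
        (add_mem (Submodule.smul_mem _ _ hone) hf.1) fun t ht => ?_
      have := abs_le.1 (hf.2 t ht)
      simp only [eval_add, eval_smul, eval_one, smul_eq_mul]
      linarith
    simp only [LinearMap.add_apply, LinearMap.sub_apply, map_add, map_sub, map_smul, smul_eq_mul,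
      hΞ1] at h1 h2
    linarith
  by_contra! hlt
  rcases le_or_gt (x ⟨0, hn⟩) 0 with h0 | h0
  · have := key 1 one_pos
    linarith
  · have := key ((Λ f - x ⟨0, hn⟩) / (2 * x ⟨0, hn⟩)) (by apply div_pos <;> linarith)
    rw [add_mul, div_mul_eq_mul_div, mul_div_mul_right _ _ h0.ne'] at this
    linarith

/-- If `M` bounds `Λ` on the unit ball, then `M` is the first entry of a vector `x` for which
`Toep x` dominates the moment matrices of `Λ` and `-Λ`. -/
theorem exists_Toep_posSemidef {n : ℕ} (hn : 0 < n) {Λ : ℝ[X] →ₗ[ℝ] ℝ} {M : ℝ}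
    (hΛ : ∀ f ∈ polyBall n, Λ f ≤ M) :
    ∃ x : Fin n → ℝ, x ⟨0, hn⟩ = M ∧
      (Toep (x - moments n Λ)).PosSemidef ∧ (Toep (x + moments n Λ)).PosSemidef := by
  have hM : 0 ≤ M := by simpa using hΛ 0 ⟨zero_mem _, by simp⟩
  let P : Set ((Fin n → ℝ) × (Fin n → ℝ)) := {q | q.1 ⟨0, hn⟩ = M ∧
    (Toep (q.1 - q.2)).PosSemidef ∧ (Toep (q.1 + q.2)).PosSemidef}
  have hPclosed : IsClosed P := by
    refine (isClosed_eq (by fun_prop) continuous_const).inter (IsClosed.inter ?_ ?_)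
    · exact (isClosed_setOf_Toep_posSemidef n).preimage (continuous_fst.sub continuous_snd)
    · exact (isClosed_setOf_Toep_posSemidef n).preimage (continuous_fst.add continuous_snd)
  have hPcompact : IsCompact P := by
    refine Metric.isCompact_of_isClosed_isBounded hPclosed
      (isBounded_iff_forall_norm_le.2 ⟨M, fun q hq => ?_⟩)
    have hb : ∀ j, |q.1 j| ≤ M ∧ |q.2 j| ≤ M := fun j => by
      have h0 := hq.1
      have h1 := abs_le.1 (abs_le_of_Toep_posSemidef hn hq.2.1 j)
      have h2 := abs_le.1 (abs_le_of_Toep_posSemidef hn hq.2.2 j)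
      simp only [Pi.sub_apply, Pi.add_apply, h0] at h1 h2
      constructor <;> rw [abs_le] <;> constructor <;> linarith
    exact max_le ((pi_norm_le_iff_of_nonneg hM).2 fun j => (hb j).1)
      ((pi_norm_le_iff_of_nonneg hM).2 fun j => (hb j).2)
  have hPconvex : Convex ℝ P := by
    intro q hq q' hq' a b ha hb hab
    refine ⟨?_, ?_, ?_⟩
    · simp only [Prod.fst_add, Prod.smul_fst, Pi.add_apply, Pi.smul_apply, hq.1, hq'.1,
        smul_eq_mul, ← add_mul, hab, one_mul]
    · convert (hq.2.1.smul ha).add (hq'.2.1.smul hb) using 1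
      rw [← Toep_smul, ← Toep_smul, ← Toep_add]
      congr 1
      simp only [Prod.fst_add, Prod.snd_add, Prod.smul_fst, Prod.smul_snd]
      module
    · convert (hq.2.2.smul ha).add (hq'.2.2.smul hb) using 1
      rw [← Toep_smul, ← Toep_smul, ← Toep_add]
      congr 1
      simp only [Prod.fst_add, Prod.snd_add, Prod.smul_fst, Prod.smul_snd]
      module
  suffices h : moments n Λ ∈ Prod.snd '' P by
    obtain ⟨q, hq, hqΛ⟩ := h
    exact ⟨q.1, hq.1, hqΛ ▸ hq.2⟩
  by_contra hnot
  obtain ⟨φ, u, hφu, hu⟩ := geometric_hahn_banach_closed_point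
    (hPconvex.linear_image (LinearMap.snd ℝ _ _)) (hPcompact.image continuous_snd).isClosed hnot
  have hφ : ∀ w : Fin n → ℝ, φ w = ∑ j, w j * φ (Pi.single j 1) := fun w => by
    exact linearMap_pi_apply φ.toLinearMap w
  -- the polynomial corresponding to the separating functional
  let p : ℝ[X] := ∑ j : Fin n, φ (Pi.single j 1) • Chebyshev.T ℝ ((j : ℕ) : ℤ)
  have hpn : p ∈ degreeLT ℝ n := sum_mem fun j _ => Submodule.smul_mem _ _ <| by
    rw [mem_degreeLT, Chebyshev.degree_T]
    exact_mod_cast j.2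
  have hΛp : Λ p = φ (moments n Λ) := by
    rw [hφ]
    simp [p, moments, mul_comm]
  have hpt : ∀ t ∈ Set.Icc (-1 : ℝ) 1, M * |p.eval t| < u := fun t ht => by
    have hpe : p.eval t = φ fun j => (Chebyshev.T ℝ ((j : ℕ) : ℤ)).eval t := by
      rw [hφ]
      simp [p, eval_finsetSum, mul_comm]
    have hmem : ∀ s : ℝ, |s| = 1 →
        (s * M) • (fun j : Fin n => (Chebyshev.T ℝ ((j : ℕ) : ℤ)).eval t) ∈ Prod.snd '' P := by
      intro s hs
      have hs' := abs_le.1 hs.le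
      refine ⟨(M • fun j : Fin n => (Chebyshev.T ℝ ((j : ℕ) : ℤ)).eval t, _), ⟨?_, ?_, ?_⟩, rfl⟩
      · simp
      · dsimp only
        rw [← sub_smul, Toep_smul]
        exact (Toep_eval_T_posSemidef ht).smul (by nlinarith)
      · dsimp only
        rw [← add_smul, Toep_smul]
        exact (Toep_eval_T_posSemidef ht).smul (by nlinarith)
    have h1 := hφu _ (hmem 1 (by simp))
    have h2 := hφu _ (hmem (-1) (by simp))
    rw [map_smul, smul_eq_mul, ← hpe] at h1 h2
    rcases abs_cases (p.eval t) with h | h <;> rw [h.1] <;> linarith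
  obtain ⟨t, ht, hmax⟩ := isCompact_Icc.exists_isMaxOn
    (Set.nonempty_Icc.2 (show (-1 : ℝ) ≤ 1 by norm_num))
    (f := fun t => |p.eval t|) (continuous_abs.comp p.continuous).continuousOn
  have hscale : ∀ δ : ℝ, 0 < δ → Λ p ≤ M * |p.eval t| + M * δ := fun δ hδ => by
    have hN : 0 < |p.eval t| + δ := by positivity
    have := hΛ ((|p.eval t| + δ)⁻¹ • p) ⟨Submodule.smul_mem _ _ hpn, fun s hs => by
      rw [eval_smul, smul_eq_mul, abs_mul, abs_of_pos (inv_pos.2 hN), inv_mul_le_iff₀ hN, mul_one]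
      have : |p.eval s| ≤ |p.eval t| := hmax hs
      linarith⟩
    rw [map_smul, smul_eq_mul, inv_mul_le_iff₀ hN] at this
    linarith
  have hgap : 0 < Λ p - M * |p.eval t| := by
    have := hpt t ht
    linarith
  have := hscale ((Λ p - M * |p.eval t|) / (2 * (M + 1))) (by positivity)
  have hlt : M * ((Λ p - M * |p.eval t|) / (2 * (M + 1))) < Λ p - M * |p.eval t| := by
    rw [mul_div_assoc', div_lt_iff₀ (by positivity)]
    nlinarith
  linarith

/-- Lagrangian duality for a linear functional over the part of the unit ball cut out by interval
constraints; no qualification condition is needed up to an arbitrarily small loss. -/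
theorem exists_multipliers {n m : ℕ} {η : ℝ} (hη : 0 < η) {y : Fin m → ℝ}
    {ℓ : Fin m → (ℝ[X] →ₗ[ℝ] ℝ)} {Q : ℝ[X] →ₗ[ℝ] ℝ} {ρ ε : ℝ} (hε : 0 < ε)
    (hy : ∃ f ∈ polyBall n, ∀ i, |ℓ i f - y i| ≤ η)
    (hQ : ∀ f ∈ polyBall n, (∀ i, |ℓ i f - y i| ≤ η) → Q f ≤ ρ) :
    ∃ u v : Fin m → ℝ, 0 ≤ u ∧ 0 ≤ v ∧ ∀ f ∈ polyBall n, (Q + ∑ i, (v i - u i) • ℓ i) f +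
      ∑ i, u i * (y i + η) - ∑ i, v i * (y i - η) ≤ ρ + ε := by
  let Φ : ℝ[X] →ₗ[ℝ] ℝ × (Fin m → ℝ) := Q.prod (LinearMap.pi ℓ)
  have hbox : ∀ b ∈ Metric.closedBall y η, ∀ i, |b i - y i| ≤ η := fun b hb i => by
    rw [mem_closedBall_iff_norm] at hb
    exact (norm_le_pi_norm (b - y) i).trans hb
  have hbox' : ∀ b : Fin m → ℝ, (∀ i, |b i - y i| ≤ η) → b ∈ Metric.closedBall y η :=
    fun b hb => mem_closedBall_iff_norm.2 ((pi_norm_le_iff_of_nonneg hη.le).2 hb)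
  obtain ⟨φ, s, t, hs, hst, ht⟩ := geometric_hahn_banach_compact_closed
    ((convex_polyBall n).linear_image Φ) (isCompact_image_polyBall n Φ)
    ((convex_singleton (ρ + ε)).prod (convex_closedBall y η))
    (isClosed_singleton.prod Metric.isClosed_closedBall) (by
      rw [Set.disjoint_left]
      rintro _ ⟨f, hf, rfl⟩ ⟨h1, h2⟩
      have h3 := hQ f hf (hbox _ h2)
      have h4 : Q f = ρ + ε := h1
      linarith)
  set α := φ (1, 0)
  let β : Fin m → ℝ := fun i => φ (0, Pi.single i 1)
  have hφ : ∀ a b, φ (a, b) = a * α + ∑ i, b i * β i := fun a b => by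
    have h1 : φ (a, b) = a • φ (1, 0) + φ (0, b) := by
      rw [← map_smul, ← map_add]
      simp
    rw [h1, smul_eq_mul]
    congr 1
    exact linearMap_pi_apply (φ.toLinearMap.comp (LinearMap.inr ℝ ℝ (Fin m → ℝ))) b
  have hΦ : ∀ f, φ (Φ f) = Q f * α + ∑ i, ℓ i f * β i := fun f => hφ _ _
  have hα : 0 < α := by
    obtain ⟨f, hf, hfy⟩ := hy
    have h1 := hs _ ⟨f, hf, rfl⟩
    have h2 := ht (ρ + ε, fun i => ℓ i f) ⟨rfl, hbox' _ hfy⟩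
    have h3 := hQ f hf hfy
    rw [hΦ] at h1
    rw [hφ] at h2
    by_contra! hα
    nlinarith
  -- the box is entered at the corner which minimizes the separating functional
  have hcorner := ht (ρ + ε, fun i => if 0 ≤ β i then y i - η else y i + η) ⟨rfl, hbox' _ fun i => by
    dsimp only
    split_ifs <;> simp [abs_of_pos hη]⟩
  rw [hφ] at hcorner
  refine ⟨fun i => (β i)⁻ / α, fun i => (β i)⁺ / α, fun i => by dsimp; positivity,
    fun i => by dsimp; positivity, fun f hf => ?_⟩
  have h1 := hs _ ⟨f, hf, rfl⟩
  rw [hΦ] at h1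
  have e1 : (Q + ∑ i, ((β i)⁺ / α - (β i)⁻ / α) • ℓ i) f = (Q f * α + ∑ i, ℓ i f * β i) / α := by
    rw [LinearMap.add_apply, LinearMap.sum_apply, add_div, mul_div_cancel_right₀ _ hα.ne',
      Finset.sum_div]
    congr 1
    refine Finset.sum_congr rfl fun i _ => ?_
    rw [← sub_div, posPart_sub_negPart, LinearMap.smul_apply, smul_eq_mul]
    ring
  have e2 : ∑ i, (β i)⁻ / α * (y i + η) - ∑ i, (β i)⁺ / α * (y i - η) =
      -(∑ i, (if 0 ≤ β i then y i - η else y i + η) * β i) / α := by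
    rw [← Finset.sum_sub_distrib, ← Finset.sum_neg_distrib, Finset.sum_div]
    refine Finset.sum_congr rfl fun i _ => ?_
    split_ifs with h
    · rw [posPart_of_nonneg h, negPart_of_nonneg h]
      ring
    · rw [posPart_of_nonpos (not_le.1 h).le, negPart_of_nonpos (not_le.1 h).le]
      ring
  rw [add_sub_assoc, e1, e2, ← add_div, div_le_iff₀ hα]
  linarith

/-- Strong duality for one of the constraint blocks of the semidefinite program. -/
theorem exists_feasible_block {n m : ℕ} (hn : 0 < n) {η : ℝ} (hη : 0 < η) {y : Fin m → ℝ}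
    {ℓ : Fin m → (ℝ[X] →ₗ[ℝ] ℝ)} {Q : ℝ[X] →ₗ[ℝ] ℝ} {ρ ε : ℝ} (hε : 0 < ε)
    (hy : ∃ f ∈ polyBall n, ∀ i, |ℓ i f - y i| ≤ η)
    (hQ : ∀ f ∈ polyBall n, (∀ i, |ℓ i f - y i| ≤ η) → Q f ≤ ρ) :
    ∃ (x : Fin n → ℝ) (u v : Fin m → ℝ), 0 ≤ u ∧ 0 ≤ v ∧
      x ⟨0, hn⟩ + ∑ i, u i * (y i + η) - ∑ i, v i * (y i - η) ≤ ρ + ε ∧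
      (Toep (x - moments n (Q + ∑ i, (v i - u i) • ℓ i))).PosSemidef ∧
      (Toep (x + moments n (Q + ∑ i, (v i - u i) • ℓ i))).PosSemidef := by
  obtain ⟨u, v, hu, hv, h⟩ := exists_multipliers hη hε hy hQ
  obtain ⟨x, hx, hsub, hadd⟩ := exists_Toep_posSemidef hn
    (Λ := Q + ∑ i, (v i - u i) • ℓ i)
    (M := ρ + ε - ∑ i, u i * (y i + η) + ∑ i, v i * (y i - η)) fun f hf => by linarith [h f hf]
  exact ⟨x, u, v, hu, hv, by linarith, hsub, hadd⟩

/-- Weak duality for one of the constraint blocks of the semidefinite program. -/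
theorem apply_le_of_feasible_block {n m : ℕ} (hn : 0 < n) {η : ℝ} {y : Fin m → ℝ}
    {ℓ : Fin m → (ℝ[X] →ₗ[ℝ] ℝ)} {Q : ℝ[X] →ₗ[ℝ] ℝ} {ρ : ℝ}
    {x : Fin n → ℝ} {u v : Fin m → ℝ} (hu : 0 ≤ u) (hv : 0 ≤ v)
    (hρ : x ⟨0, hn⟩ + ∑ i, u i * (y i + η) - ∑ i, v i * (y i - η) ≤ ρ)
    (hsub : (Toep (x - moments n (Q + ∑ i, (v i - u i) • ℓ i))).PosSemidef)
    (hadd : (Toep (x + moments n (Q + ∑ i, (v i - u i) • ℓ i))).PosSemidef)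
    {f : ℝ[X]} (hf : f ∈ polyBall n) (hfy : ∀ i, |ℓ i f - y i| ≤ η) : Q f ≤ ρ := by
  have h1 := apply_le_of_Toep_posSemidef hn hsub hadd hf
  have h2 : ∑ i, u i * ℓ i f ≤ ∑ i, u i * (y i + η) := Finset.sum_le_sum fun i _ =>
    mul_le_mul_of_nonneg_left (by linarith [(abs_le.1 (hfy i)).2]) (hu i)
  have h3 : ∑ i, v i * (y i - η) ≤ ∑ i, v i * ℓ i f := Finset.sum_le_sum fun i _ =>
    mul_le_mul_of_nonneg_left (by linarith [(abs_le.1 (hfy i)).1]) (hv i)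
  simp only [LinearMap.add_apply, LinearMap.sum_apply, LinearMap.smul_apply, smul_eq_mul, sub_mul,
    Finset.sum_sub_distrib] at h1
  linarith

theorem Toep_moments_combination {n m : ℕ} (Q : ℝ[X] →ₗ[ℝ] ℝ) (ℓ : Fin m → (ℝ[X] →ₗ[ℝ] ℝ))
    (a : Fin m → ℝ) :
    Toep (moments n (Q + ∑ i, a i • ℓ i)) =
      Toep (moments n Q) + ∑ i, a i • Toep (moments n (ℓ i)) := by
  ext j k
  simp [Toep, moments, Matrix.sum_apply]

/-- Local optimality when the model set is the unit ball of the space of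
polynomials of degree `< n` with the sup norm on `[-1,1]`: the semidefinite program computes
the Chebyshev radius of `Q(K_E(y))` in `ℓ_∞^K`, and the `z`-component of any minimizer is a
Chebyshev center of `Q(K_E(y))`. -/
theorem sdp_computes_chebyshev_center_polynomial_ball_model
    (n m K : ℕ) (hn : 0 < n)
    (η : ℝ) (hη : 0 < η) (y : Fin m → ℝ)
    (ℓ : Fin m → (Polynomial ℝ →ₗ[ℝ] ℝ))
    (Qf : Fin K → (Polynomial ℝ →ₗ[ℝ] ℝ))
    -- the model set: unit ball of the polynomials of degree < n in the sup norm on [-1,1]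
    (Kset : Set (Polynomial ℝ))
    (hKset : Kset = {f | f ∈ Polynomial.degreeLT ℝ n ∧
      ∀ x ∈ Set.Icc (-1 : ℝ) 1, |f.eval x| ≤ 1})
    -- the data y is attainable: y ∈ L(K) + E
    (hy : ∃ f ∈ Kset, ∀ i, |ℓ i f - y i| ≤ η)
    -- the set K_E(y) of model-consistent and data-consistent polynomials
    (KE : Set (Polynomial ℝ))
    (hKE : KE = {f ∈ Kset | ∀ i, |ℓ i f - y i| ≤ η})
    -- its image S = Q(K_E(y)) in ℓ_∞^K
    (S : Set (Fin K → ℝ)) (hS : S = (fun f => fun k => Qf k f) '' KE)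
    -- the Chebyshev radius of S with respect to the sup norm on ℝ^K
    (rad : ℝ)
    (hrad : rad = sInf {r : ℝ | ∃ c : Fin K → ℝ, ∀ s ∈ S, ‖s - c‖ ≤ r})
    -- the auxiliary Toeplitz matrices C_k and A_i of Chebyshev coefficients
    (Cmat : Fin K → Matrix (Fin n) (Fin n) ℝ)
    (hC : Cmat = fun k => Toep (fun j => Qf k (Polynomial.Chebyshev.T ℝ ((j : ℕ) : ℤ))))
    (Amat : Fin m → Matrix (Fin n) (Fin n) ℝ)
    (hA : Amat = fun i => Toep (fun j => ℓ i (Polynomial.Chebyshev.T ℝ ((j : ℕ) : ℤ))))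
    -- feasibility predicate of the semidefinite program
    (Feas : (Fin K → ℝ) → ℝ → (Fin K → Fin n → ℝ) → (Fin K → Fin n → ℝ) →
      (Fin K → Fin m → ℝ) → (Fin K → Fin m → ℝ) →
      (Fin K → Fin m → ℝ) → (Fin K → Fin m → ℝ) → Prop)
    (hFeas : Feas = fun z r xp xm up um vp vm => ∀ k : Fin K,
      xp k ⟨0, hn⟩ + ∑ i, up k i * (y i + η) - ∑ i, vp k i * (y i - η) ≤ r + z k ∧
      xm k ⟨0, hn⟩ + ∑ i, um k i * (y i + η) - ∑ i, vm k i * (y i - η) ≤ r - z k ∧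
      0 ≤ up k ∧ 0 ≤ um k ∧ 0 ≤ vp k ∧ 0 ≤ vm k ∧
      (Toep (xp k) - (Cmat k + ∑ i, (vp k i - up k i) • Amat i)).PosSemidef ∧
      (Toep (xp k) + (Cmat k + ∑ i, (vp k i - up k i) • Amat i)).PosSemidef ∧
      (Toep (xm k) - (-(Cmat k) + ∑ i, (vm k i - um k i) • Amat i)).PosSemidef ∧
      (Toep (xm k) + (-(Cmat k) + ∑ i, (vm k i - um k i) • Amat i)).PosSemidef)
    -- the values of the semidefinite program
    (SDPvals : Set ℝ)
    (hSDP : SDPvals = {r : ℝ | ∃ z xp xm up um vp vm, Feas z r xp xm up um vp vm}) :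
    -- conclusion: the optimal SDP value is the Chebyshev radius, and the z-component
    -- of any minimizer is a Chebyshev center of S
    sInf SDPvals = rad ∧
    ∀ z r xp xm up um vp vm, Feas z r xp xm up um vp vm → r = sInf SDPvals →
      ∀ s ∈ S, ‖s - z‖ ≤ rad := by
  have hball : Kset = polyBall n := hKset
  subst hball
  have hFeas' : ∀ z r xp xm up um vp vm, Feas z r xp xm up um vp vm ↔ ∀ k : Fin K,
      (xp k ⟨0, hn⟩ + ∑ i, up k i * (y i + η) - ∑ i, vp k i * (y i - η) ≤ r + z k ∧
        0 ≤ up k ∧ 0 ≤ vp k ∧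
        (Toep (xp k - moments n (Qf k + ∑ i, (vp k i - up k i) • ℓ i))).PosSemidef ∧
        (Toep (xp k + moments n (Qf k + ∑ i, (vp k i - up k i) • ℓ i))).PosSemidef) ∧
      (xm k ⟨0, hn⟩ + ∑ i, um k i * (y i + η) - ∑ i, vm k i * (y i - η) ≤ r - z k ∧
        0 ≤ um k ∧ 0 ≤ vm k ∧
        (Toep (xm k - moments n (-Qf k + ∑ i, (vm k i - um k i) • ℓ i))).PosSemidef ∧
        (Toep (xm k + moments n (-Qf k + ∑ i, (vm k i - um k i) • ℓ i))).PosSemidef) := by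
    intro z r xp xm up um vp vm
    have hA' : ∀ i, Amat i = Toep (moments n (ℓ i)) := fun i => congrFun hA i
    have hC' : ∀ k, Cmat k = Toep (moments n (Qf k)) := fun k => congrFun hC k
    have hC'' : ∀ k, -Toep (moments n (Qf k)) = Toep (moments n (-Qf k)) := fun k => rfl
    rw [hFeas]
    simp only [hA', hC', hC'', ← Toep_moments_combination, ← Toep_sub, ← Toep_add]
    exact forall_congr' fun k => by tauto
  have hSmem : ∀ f ∈ polyBall n, (∀ i, |ℓ i f - y i| ≤ η) → (fun k => Qf k f) ∈ S :=
    fun f hf hfy => by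
      rw [hS, hKE]
      exact ⟨f, ⟨hf, hfy⟩, rfl⟩
  have hSne : ∃ s, s ∈ S := by
    obtain ⟨f, hf, hfy⟩ := hy
    exact ⟨_, hSmem f hf hfy⟩
  have weak : ∀ z r xp xm up um vp vm, Feas z r xp xm up um vp vm →
      ∀ s ∈ S, ∀ k, |s k - z k| ≤ r := by
    intro z r xp xm up um vp vm h s hs k
    rw [hS, hKE] at hs
    obtain ⟨f, ⟨hf, hfy⟩, rfl⟩ := hs
    obtain ⟨⟨hp, hup, hvp, hp1, hp2⟩, hm, hum, hvm, hm1, hm2⟩ :=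
      (hFeas' _ _ _ _ _ _ _ _).1 h k
    have h1 := apply_le_of_feasible_block hn hup hvp hp hp1 hp2 hf hfy
    have h2 := apply_le_of_feasible_block hn hum hvm hm hm1 hm2 hf hfy
    rw [LinearMap.neg_apply] at h2
    exact abs_le.2 ⟨by linarith, by linarith⟩
  have strong : ∀ z r, (∀ s ∈ S, ‖s - z‖ ≤ r) → ∀ ε > 0, r + ε ∈ SDPvals := by
    intro z r h ε hε
    have hk : ∀ k, ∀ f ∈ polyBall n, (∀ i, |ℓ i f - y i| ≤ η) → |Qf k f - z k| ≤ r :=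
      fun k f hf hfy => (norm_le_pi_norm _ k).trans (h _ (hSmem f hf hfy))
    choose xp up vp hup hvp hp hp1 hp2 using fun k => exists_feasible_block hn hη hε hy
      (Q := Qf k) (ρ := r + z k) fun f hf hfy => by linarith [(abs_le.1 (hk k f hf hfy)).2]
    choose xm um vm hum hvm hm hm1 hm2 using fun k => exists_feasible_block hn hη hε hy
      (Q := -Qf k) (ρ := r - z k) fun f hf hfy => by
        rw [LinearMap.neg_apply]
        linarith [(abs_le.1 (hk k f hf hfy)).1]
    rw [hSDP]
    refine ⟨z, xp, xm, up, um, vp, vm, (hFeas' _ _ _ _ _ _ _ _).2 fun k => ⟨⟨?_, hup k, hvp k,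
      hp1 k, hp2 k⟩, ?_, hum k, hvm k, hm1 k, hm2 k⟩⟩
    · linarith [hp k]
    · linarith [hm k]
  rcases Nat.eq_zero_or_pos K with rfl | hK
  · -- without quantities of interest every real number is a value of the program
    have hvals : SDPvals = Set.univ := by
      rw [hSDP]
      refine Set.eq_univ_of_forall fun r => ⟨0, 0, 0, 0, 0, 0, 0, ?_⟩
      rw [hFeas']
      exact fun k => k.elim0
    have hnorm : ∀ s : Fin 0 → ℝ, ‖s‖ = 0 := fun s => by
      rw [Subsingleton.elim s 0, norm_zero]
    have hrad0 : rad = 0 := by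
      have : {r : ℝ | ∃ c : Fin 0 → ℝ, ∀ s ∈ S, ‖s - c‖ ≤ r} = Set.Ici 0 := by
        ext r
        simp only [hnorm, Set.mem_ofPred_eq, Set.mem_Ici]
        exact ⟨fun ⟨_, h⟩ => h _ hSne.choose_spec, fun h => ⟨0, fun _ _ => h⟩⟩
      rw [hrad, this, csInf_Ici]
    refine ⟨by rw [hvals, hrad0, Real.sInf_univ], fun z r _ _ _ _ _ _ _ _ s _ => ?_⟩
    rw [hnorm, hrad0]
  have weak_norm : ∀ z r xp xm up um vp vm, Feas z r xp xm up um vp vm →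
      ∀ s ∈ S, ‖s - z‖ ≤ r := by
    intro z r xp xm up um vp vm h s hs
    have hr : 0 ≤ r := (abs_nonneg _).trans (weak z r xp xm up um vp vm h s hs ⟨0, hK⟩)
    exact (pi_norm_le_iff_of_nonneg hr).2 (weak z r xp xm up um vp vm h s hs)
  have hsub : SDPvals ⊆ {r : ℝ | ∃ c : Fin K → ℝ, ∀ s ∈ S, ‖s - c‖ ≤ r} := by
    rw [hSDP]
    rintro r ⟨z, xp, xm, up, um, vp, vm, h⟩
    exact ⟨z, weak_norm z r xp xm up um vp vm h⟩
  have hbdd : BddBelow {r : ℝ | ∃ c : Fin K → ℝ, ∀ s ∈ S, ‖s - c‖ ≤ r} := by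
    obtain ⟨s, hs⟩ := hSne
    exact ⟨0, fun r ⟨c, hc⟩ => (norm_nonneg _).trans (hc s hs)⟩
  have hval : sInf SDPvals = rad := by
    rw [hrad]
    rcases Set.eq_empty_or_nonempty {r : ℝ | ∃ c : Fin K → ℝ, ∀ s ∈ S, ‖s - c‖ ≤ r} with h0 | h0
    · rw [h0] at hsub ⊢
      rw [Set.subset_empty_iff.1 hsub]
    have hne : SDPvals.Nonempty := by
      obtain ⟨r, c, hc⟩ := h0
      exact ⟨_, strong c r hc 1 one_pos⟩
    refine le_antisymm (le_csInf h0 ?_) (csInf_le_csInf hbdd hne hsub)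
    rintro r ⟨c, hc⟩
    exact le_of_forall_pos_le_add fun ε hε => csInf_le (hbdd.mono hsub) (strong c r hc ε hε)
  refine ⟨hval, fun z r xp xm up um vp vm h hr s hs => ?_⟩
  rw [← hval, ← hr]
  exact weak_norm z r xp xm up um vp vm h s hs
end

section
/- Let X be a normed real vector space, let Q, ℓ_1,…,ℓ_m be continuous linear functionals on X, let a ∈ ℝ^m, let p ∈ [1,∞] with conjugate exponent p′, and let η, ε > 0. Then sup { |Q(f) − Σ_{i=1}^m a_i(ℓ_i(f) + e_i)| : f ∈ X, ‖f‖_X ≤ 1, e ∈ ℝ^m, ‖e‖_p ≤ η/ε } = ‖Q − Σ_{i=1}^m a_i ℓ_i‖_{X*} + (η/ε)‖a‖_{p′}. -/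
open scoped ENNReal

/-- **Hölder's inequality** for the pairing of finite `ℓ_q` and `ℓ_p`, endpoints included. -/
theorem PiLp.abs_sum_mul_le_norm_mul_norm {ι : Type*} [Fintype ι] {p q : ℝ≥0∞}
    [Fact (1 ≤ p)] [Fact (1 ≤ q)] (hpq : p⁻¹ + q⁻¹ = 1)
    (a : PiLp q (fun _ : ι => ℝ)) (e : PiLp p (fun _ : ι => ℝ)) :
    |∑ i, a i * e i| ≤ ‖a‖ * ‖e‖ := by
  have : p.HolderConjugate q := ENNReal.holderConjugate_iff.2 hpq
  refine (Finset.abs_sum_le_sum_abs _ _).trans ?_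
  simp only [abs_mul]
  rcases eq_or_ne p ∞ with rfl | hp
  · obtain rfl : q = 1 := by simpa using hpq
    rw [PiLp.norm_eq_of_L1, Finset.sum_mul]
    exact Finset.sum_le_sum fun i _ =>
      mul_le_mul_of_nonneg_left (PiLp.norm_apply_le e i) (abs_nonneg _)
  rcases eq_or_ne q ∞ with rfl | hq
  · obtain rfl : p = 1 := by simpa using hpq
    rw [PiLp.norm_eq_of_L1 e, Finset.mul_sum]
    exact Finset.sum_le_sum fun i _ =>
      mul_le_mul_of_nonneg_right (PiLp.norm_apply_le a i) (abs_nonneg _)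
  have hr := (ENNReal.HolderConjugate.toReal_of_ne_top hp hq).symm
  rw [PiLp.norm_eq_sum hr.pos, PiLp.norm_eq_sum hr.symm.pos]
  simpa using Real.inner_le_Lp_mul_Lq Finset.univ (fun i => |a i|) (fun i => |e i|) hr

/-- Every vector of finite `ℓ_q` is normed by a vector of the unit ball of the conjugate `ℓ_p`. -/
theorem PiLp.exists_norm_le_one_sum_mul_eq_norm {ι : Type*} [Fintype ι] {p q : ℝ≥0∞}
    [Fact (1 ≤ p)] [Fact (1 ≤ q)] (hpq : p⁻¹ + q⁻¹ = 1) (a : PiLp q (fun _ : ι => ℝ)) :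
    ∃ e : PiLp p (fun _ : ι => ℝ), ‖e‖ ≤ 1 ∧ ∑ i, a i * e i = ‖a‖ := by
  classical
  have : p.HolderConjugate q := ENNReal.holderConjugate_iff.2 hpq
  have sign_le (x : ℝ) : |(SignType.sign x : ℝ)| ≤ 1 := by
    rcases lt_trichotomy x 0 with h | rfl | h <;> simp [*]
  rcases eq_or_ne p ∞ with rfl | hp
  · obtain rfl : q = 1 := by simpa using hpq
    refine ⟨WithLp.toLp ∞ fun i => (SignType.sign (a i) : ℝ), ?_, ?_⟩
    · rw [PiLp.norm_toLp, pi_norm_le_iff_of_nonneg zero_le_one]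
      exact fun i => sign_le _
    · simp [PiLp.norm_eq_of_L1, self_mul_sign]
  rcases eq_or_ne q ∞ with rfl | hq
  · obtain rfl : p = 1 := by simpa using hpq
    rcases isEmpty_or_nonempty ι with hι | hι
    · exact ⟨0, by simp, by simp [PiLp.norm_eq_ciSup]⟩
    · obtain ⟨i, hi⟩ := exists_eq_ciSup_of_finite (f := fun i => ‖a i‖)
      refine ⟨PiLp.single 1 i (SignType.sign (a i) : ℝ), ?_, ?_⟩
      · rw [PiLp.norm_single]
        exact sign_le _
      · rw [PiLp.norm_eq_ciSup, ← hi]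
        simp [self_mul_sign]
  have hr := (ENNReal.HolderConjugate.toReal_of_ne_top hp hq).symm
  obtain ⟨g, hg, hsum⟩ := (NNReal.isGreatest_Lp Finset.univ (fun i => ‖a i‖₊) hr).1
  refine ⟨WithLp.toLp p fun i => (SignType.sign (a i) : ℝ) * g i, ?_, ?_⟩
  · rw [PiLp.norm_eq_sum hr.symm.pos]
    refine Real.rpow_le_one (by positivity) ?_ hr.symm.one_div_nonneg
    have hg' : ∑ i, (g i : ℝ) ^ p.toReal ≤ 1 := by
      simpa using NNReal.coe_le_coe.2 hg
    refine (Finset.sum_le_sum fun i _ => ?_).trans hg'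
    refine Real.rpow_le_rpow (norm_nonneg _) ?_ hr.symm.nonneg
    simpa [abs_mul] using mul_le_mul_of_nonneg_right (sign_le (a i)) (g i).2
  · rw [PiLp.norm_eq_sum hr.pos]
    have := congrArg NNReal.toReal hsum
    simpa [← mul_assoc, self_mul_sign] using this

/-- Transformation of the objective function: the worst-case error of the
linear functional `y ↦ Σ aᵢ yᵢ` over the unit ball of `X` and the ℓ_p-ball of radius `η/ε`
equals the dual norm of `Q - Σ aᵢ ℓᵢ` plus `(η/ε)` times the ℓ_{p'} norm of `a`. -/
theorem sup_error_eq_dual_norm_add_conjugate_norm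
    (X : Type*) [NormedAddCommGroup X] [NormedSpace ℝ X]
    (m : ℕ) (Q : X →L[ℝ] ℝ) (ℓ : Fin m → X →L[ℝ] ℝ)
    (a : Fin m → ℝ)
    (p p' : ℝ≥0∞) [Fact (1 ≤ p)] [Fact (1 ≤ p')]
    (hpp' : p⁻¹ + p'⁻¹ = 1)
    (η ε : ℝ) (hη : 0 < η) (hε : 0 < ε) :
    sSup {c : ℝ | ∃ (f : X) (e : PiLp p (fun _ : Fin m => ℝ)),
        ‖f‖ ≤ 1 ∧ ‖e‖ ≤ η / ε ∧
        c = |Q f - ∑ i, a i * (ℓ i f + WithLp.equiv p (Fin m → ℝ) e i)|}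
      = ‖Q - ∑ i, a i • ℓ i‖ + η / ε * ‖(WithLp.equiv p' (Fin m → ℝ)).symm a‖ := by
  have hr : 0 ≤ η / ε := by positivity
  generalize η / ε = r at hr
  set L := Q - ∑ i, a i • ℓ i with hL
  set b : PiLp p' (fun _ : Fin m => ℝ) := (WithLp.equiv p' (Fin m → ℝ)).symm a
  have split (f : X) (e : PiLp p (fun _ : Fin m => ℝ)) :
      Q f - ∑ i, a i * (ℓ i f + WithLp.equiv p (Fin m → ℝ) e i) = L f - ∑ i, b i * e i := by
    simp [hL, b, mul_add, Finset.sum_add_distrib, sub_sub]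
  simp only [split]
  refine csSup_eq_of_forall_le_of_forall_lt_exists_gt ⟨_, 0, 0, by simp, by simpa, rfl⟩ ?_ ?_
  · rintro _ ⟨f, e, hf, he, rfl⟩
    calc |L f - ∑ i, b i * e i| ≤ |L f| + |∑ i, b i * e i| := abs_sub _ _
      _ ≤ ‖L‖ + r * ‖b‖ := by
        refine add_le_add (L.unit_le_opNorm f hf) ?_
        rw [mul_comm r]
        exact (PiLp.abs_sum_mul_le_norm_mul_norm hpp' b e).trans (by gcongr)
  · intro c hc
    obtain ⟨f, hf, hLf⟩ := L.exists_lt_apply_of_lt_opNorm (sub_lt_iff_lt_add.2 hc)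
    obtain ⟨e, he, hbe⟩ := PiLp.exists_norm_le_one_sum_mul_eq_norm hpp' b
    have pairing (s : ℝ) : ∑ i, b i * (s • e) i = s * ‖b‖ := by
      simp [← hbe, Finset.mul_sum, mul_left_comm]
    have ball (s : ℝ) (hs : |s| = r) : ‖s • e‖ ≤ r := by
      rw [norm_smul, Real.norm_eq_abs, hs]
      exact mul_le_of_le_one_right hr he
    rw [Real.norm_eq_abs] at hLf
    rcases abs_cases (L f) with ⟨h, -⟩ | ⟨h, -⟩
    · refine ⟨_, ⟨f, (-r) • e, hf.le, ball _ (by simpa), rfl⟩, ?_⟩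
      rw [pairing]
      exact lt_of_lt_of_le (by linarith) (le_abs_self _)
    · refine ⟨_, ⟨f, r • e, hf.le, ball _ (by simpa), rfl⟩, ?_⟩
      rw [pairing]
      exact lt_of_lt_of_le (by linarith) (neg_le_abs _)
end

section
/- Let X be a normed real vector space, V ⊆ X a linear subspace, Z a normed real vector space, Q : X → Z a continuous linear map, ℓ_1,…,ℓ_m continuous linear functionals on X with L(f) = (ℓ_1(f),…,ℓ_m(f)), and ε, η > 0, p ∈ [1,∞]. Then the compatibility indicator of the augmented problem satisfies μ_{Ṽ,Q̃}(L̃) = sup { ‖Q(f)‖_Z / max{dist_X(f,V), (ε/η)‖L(f)‖_p} : f ∈ X, max{dist_X(f,V), (ε/η)‖L(f)‖_p} > 0 }, and moreover μ_{Ṽ,Q̃}(L̃) ≥ μ_{V,Q}(L) := sup { ‖Q(f)‖_Z / dist_X(f,V) : f ∈ ker L, f ∉ V }. -/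
open scoped ENNReal

section

variable {X : Type*} [NormedAddCommGroup X] [NormedSpace ℝ X]
  {Z : Type*} [NormedAddCommGroup Z] [NormedSpace ℝ Z]
  {E : Type*} [NormedAddCommGroup E] [NormedSpace ℝ E]

/-- For every `r` above the distance of `f` to a subspace, some vector of the subspace is closer
than `r` to `f`. -/
theorem Submodule.exists_norm_sub_lt_of_infDist_lt (V : Submodule ℝ X) {f : X} {r : ℝ}
    (h : Metric.infDist f (V : Set X) < r) : ∃ v ∈ V, ‖f - v‖ < r := by
  obtain ⟨v, hv, hd⟩ := (Metric.infDist_lt_iff ⟨0, V.zero_mem⟩).1 h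
  exact ⟨v, hv, by rwa [← dist_eq_norm]⟩

/-- The distance to `V × {0}` in a weighted max-norm product is the weighted maximum of the
distances to the two factors. -/
theorem Submodule.sInf_max_norm_sub_eq {F : Type*} [NormedAddCommGroup F]
    (V : Submodule ℝ X) (c : ℝ) (f : X) (e : F) :
    sInf {d : ℝ | ∃ v ∈ V, ∃ w ∈ ({0} : Set F), d = max ‖f - v‖ (c * ‖e - w‖)} =
      max (Metric.infDist f (V : Set X)) (c * ‖e‖) := by
  apply le_antisymm
  · refine le_of_forall_pos_le_add fun δ hδ => ?_
    obtain ⟨v, hv, hlt⟩ := V.exists_norm_sub_lt_of_infDist_lt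
      (lt_add_of_pos_right (Metric.infDist f (V : Set X)) hδ)
    have hbdd : BddBelow {d : ℝ | ∃ v ∈ V, ∃ w ∈ ({0} : Set F),
        d = max ‖f - v‖ (c * ‖e - w‖)} := by
      refine ⟨0, ?_⟩
      rintro d ⟨v, -, w, -, rfl⟩
      exact le_max_of_le_left (norm_nonneg _)
    refine (csInf_le hbdd ⟨v, hv, 0, rfl, rfl⟩).trans ?_
    rw [sub_zero]
    refine max_le (hlt.le.trans ?_) ((le_max_right _ _).trans (le_add_of_nonneg_right hδ.le))
    gcongr
    exact le_max_left _ _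
  · refine le_csInf ⟨_, 0, V.zero_mem, 0, rfl, rfl⟩ ?_
    rintro d ⟨v, hv, w, rfl, rfl⟩
    rw [sub_zero]
    refine max_le_max ?_ le_rfl
    rw [← dist_eq_norm]
    exact Metric.infDist_le_dist_of_mem hv

/-- If `Q` vanishes on the kernel of `L` within `V` and `L` has finite rank, then `Q` is dominated
by `L` on `V`. -/
theorem Submodule.exists_norm_le_mul_norm_of_ker_le [FiniteDimensional ℝ E] (V : Submodule ℝ X)
    (L : X →L[ℝ] E) (Q : X →L[ℝ] Z) (h : ∀ v ∈ V, L v = 0 → Q v = 0) :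
    ∃ K, 0 ≤ K ∧ ∀ v ∈ V, ‖Q v‖ ≤ K * ‖L v‖ := by
  let T : V →ₗ[ℝ] E := L.toLinearMap ∘ₗ V.subtype
  obtain ⟨s, hs⟩ := T.rangeRestrict.exists_rightInverse_of_surjective T.range_rangeRestrict
  let R : T.range →L[ℝ] Z := (Q.toLinearMap ∘ₗ V.subtype ∘ₗ s).toContinuousLinearMap
  refine ⟨‖R‖, R.opNorm_nonneg, fun v hv => ?_⟩
  have hT : T (s (T.rangeRestrict ⟨v, hv⟩)) = T ⟨v, hv⟩ :=
    congrArg Subtype.val (LinearMap.congr_fun hs (T.rangeRestrict ⟨v, hv⟩))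
  have hQ : Q (v - s (T.rangeRestrict ⟨v, hv⟩)) = 0 := by
    refine h _ (V.sub_mem hv (s _).2) ?_
    rw [map_sub, sub_eq_zero]
    exact hT.symm
  rw [map_sub, sub_eq_zero] at hQ
  rw [hQ]
  exact R.le_opNorm (T.rangeRestrict ⟨v, hv⟩)

/-- The distance to a subspace is invariant under translation by its elements. -/
theorem Submodule.infDist_add_of_mem (V : Submodule ℝ X) {u : X} (hu : u ∈ V) (g : X) :
    Metric.infDist (u + g) (V : Set X) = Metric.infDist g (V : Set X) := by
  have key : ∀ w ∈ V, ∀ x : X,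
      Metric.infDist (w + x) (V : Set X) ≤ Metric.infDist x (V : Set X) := by
    intro w hw x
    refine (Metric.le_infDist ⟨0, V.zero_mem⟩).2 fun v hv => ?_
    calc Metric.infDist (w + x) (V : Set X) ≤ dist (w + x) (w + v) :=
          Metric.infDist_le_dist_of_mem (V.add_mem hw hv)
      _ = dist x v := dist_add_left _ _ _
  refine le_antisymm (key u hu g) ?_
  simpa using key (-u) (V.neg_mem hu) (u + g)

/-- If the ratios `‖Q f‖ / dist(f, V)` are bounded on `ker L` and `ker L` is not contained in the
closure of `V`, then `Q` vanishes on `V ∩ ker L`. -/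
theorem Submodule.eq_zero_of_bddAbove_ratio (V : Submodule ℝ X) (L : X →L[ℝ] E) (Q : X →L[ℝ] Z)
    {M : ℝ} (hM : ∀ f, L f = 0 → 0 < Metric.infDist f (V : Set X) →
      ‖Q f‖ ≤ M * Metric.infDist f (V : Set X))
    {g : X} (hg : L g = 0) (hgV : 0 < Metric.infDist g (V : Set X))
    {u : X} (hu : u ∈ V) (hLu : L u = 0) : Q u = 0 := by
  by_contra hne
  have hpos : 0 < ‖Q u‖ := norm_pos_iff.2 hne
  set B := M * Metric.infDist g (V : Set X) + ‖Q g‖ with hB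
  obtain ⟨n, hn⟩ := exists_nat_gt (B / ‖Q u‖)
  rw [div_lt_iff₀ hpos] at hn
  have hd := V.infDist_add_of_mem (V.smul_mem (n : ℝ) hu) g
  have hbound := hM ((n : ℝ) • u + g) (by simp [hg, hLu]) (by rwa [hd])
  rw [hd] at hbound
  have htri : ‖(n : ℝ) • Q u‖ ≤ ‖Q ((n : ℝ) • u + g)‖ + ‖Q g‖ := by
    have h := norm_sub_le (Q ((n : ℝ) • u + g)) (Q g)
    simpa using h
  rw [norm_smul, Real.norm_natCast] at htri
  linarith

/-- If `Q` is dominated by `L` on `V`, then it is dominated everywhere by the maximum of the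
distance to `V` and a positive multiple of the norm of `L`. -/
theorem Submodule.exists_norm_le_mul_max_infDist (V : Submodule ℝ X) (L : X →L[ℝ] E)
    (Q : X →L[ℝ] Z) {c K : ℝ} (hc : 0 < c) (hK : 0 ≤ K) (h : ∀ v ∈ V, ‖Q v‖ ≤ K * ‖L v‖) :
    ∃ C, ∀ f, 0 < max (Metric.infDist f (V : Set X)) (c * ‖L f‖) →
      ‖Q f‖ ≤ C * max (Metric.infDist f (V : Set X)) (c * ‖L f‖) := by
  refine ⟨‖Q‖ * 2 + K * (c⁻¹ + ‖L‖ * 2), fun f hf => ?_⟩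
  set D := max (Metric.infDist f (V : Set X)) (c * ‖L f‖) with hD
  have h1 : Metric.infDist f (V : Set X) ≤ D := le_max_left _ _
  have h2 : ‖L f‖ ≤ c⁻¹ * D := by
    rw [inv_mul_eq_div, le_div_iff₀' hc]
    exact le_max_right _ _
  obtain ⟨v, hv, hlt⟩ := V.exists_norm_sub_lt_of_infDist_lt (f := f) (r := 2 * D) (by linarith)
  have hQ : ‖Q f‖ ≤ ‖Q (f - v)‖ + ‖Q v‖ := by
    simpa using norm_add_le (Q (f - v)) (Q v)
  have hL : ‖L v‖ ≤ ‖L f‖ + ‖L (f - v)‖ := by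
    simpa using norm_sub_le (L f) (L (f - v))
  calc ‖Q f‖ ≤ ‖Q (f - v)‖ + K * ‖L v‖ := hQ.trans (by gcongr; exact h v hv)
    _ ≤ ‖Q‖ * (2 * D) + K * (c⁻¹ * D + ‖L‖ * (2 * D)) := by
      gcongr
      · exact Q.le_opNorm_of_le hlt.le
      · exact hL.trans (add_le_add h2 (L.le_opNorm_of_le hlt.le))
    _ = _ := by ring

/-- Adjoining values equal to zero does not change the real supremum of a set of nonnegative
numbers. -/
theorem Real.sSup_eq_of_subset_of_subset_insert_zero {A B : Set ℝ} (hB : ∀ b ∈ B, 0 ≤ b)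
    (hBA : B ⊆ A) (hAB : A ⊆ insert 0 B) : sSup A = sSup B := by
  have hA : ∀ a ∈ A, 0 ≤ a := fun a ha => (hAB ha).elim (fun h => h.ge) (hB a)
  by_cases hbdd : BddAbove B
  · apply le_antisymm
    · refine Real.sSup_le (fun a ha => ?_) (Real.sSup_nonneg hB)
      rcases hAB ha with rfl | hb
      · exact Real.sSup_nonneg hB
      · exact le_csSup hbdd hb
    · exact Real.sSup_le (fun b hb => le_csSup ((hbdd.insert 0).mono hAB) (hBA hb))
        (Real.sSup_nonneg hA)
  · rw [Real.sSup_of_not_bddAbove hbdd, Real.sSup_of_not_bddAbove fun h => hbdd (h.mono hBA)]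

/-- The supremum of the ratios `‖Q f‖ / dist(f, V)` over `ker L` is at most the supremum of the
ratios `‖Q f‖ / max (dist(f, V)) (c ‖L f‖)` over the whole space. If the latter is infinite, then
the former is infinite or all its ratios have denominator zero, so the bound also holds for the
real-valued supremum. -/
theorem Submodule.sSup_ratio_ker_le [FiniteDimensional ℝ E] (V : Submodule ℝ X)
    (L : X →L[ℝ] E) (Q : X →L[ℝ] Z) {c : ℝ} (hc : 0 < c) :
    sSup {r : ℝ | ∃ f : X, L f = 0 ∧ f ∉ V ∧ r = ‖Q f‖ / Metric.infDist f (V : Set X)} ≤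
      sSup {r : ℝ | ∃ f : X, 0 < max (Metric.infDist f (V : Set X)) (c * ‖L f‖) ∧
        r = ‖Q f‖ / max (Metric.infDist f (V : Set X)) (c * ‖L f‖)} := by
  set S := {r : ℝ | ∃ f : X, L f = 0 ∧ f ∉ V ∧ r = ‖Q f‖ / Metric.infDist f (V : Set X)}
  set B := {r : ℝ | ∃ f : X, 0 < max (Metric.infDist f (V : Set X)) (c * ‖L f‖) ∧
    r = ‖Q f‖ / max (Metric.infDist f (V : Set X)) (c * ‖L f‖)}
  have hB : 0 ≤ sSup B := by
    refine Real.sSup_nonneg ?_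
    rintro _ ⟨f, hf, rfl⟩
    positivity
  by_cases hS : BddAbove S
  swap
  · rwa [Real.sSup_of_not_bddAbove hS]
  obtain ⟨M, hM⟩ := hS
  refine Real.sSup_le ?_ hB
  rintro _ ⟨g, hg, -, rfl⟩
  rcases (Metric.infDist_nonneg (x := g) (s := (V : Set X))).eq_or_lt with h0 | hpos
  · rwa [← h0, div_zero]
  have hratio : ∀ f, L f = 0 → 0 < Metric.infDist f (V : Set X) →
      ‖Q f‖ ≤ M * Metric.infDist f (V : Set X) := fun f hf hfV =>
    (div_le_iff₀ hfV).1 (hM ⟨f, hf, fun hmem =>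
      hfV.ne' (Metric.infDist_zero_of_mem hmem), rfl⟩)
  obtain ⟨K, hK, hQL⟩ := V.exists_norm_le_mul_norm_of_ker_le L Q fun u hu hLu =>
    V.eq_zero_of_bddAbove_ratio L Q hratio hg hpos hu hLu
  obtain ⟨C, hC⟩ := V.exists_norm_le_mul_max_infDist L Q hc hK hQL
  have hbdd : BddAbove B := by
    refine ⟨C, ?_⟩
    rintro _ ⟨f, hf, rfl⟩
    exact (div_le_iff₀ hf).2 (hC f hf)
  have hmax : max (Metric.infDist g (V : Set X)) (c * ‖L g‖) = Metric.infDist g (V : Set X) := by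
    simp [hg, Metric.infDist_nonneg]
  exact le_csSup hbdd ⟨g, by rwa [hmax], by rw [hmax]⟩

end

/-- Formula for the compatibility indicator of the augmented problem, and
comparison with the accurate compatibility indicator. -/
theorem compatibility_indicator_formula_and_lower_bound
    (X : Type*) [NormedAddCommGroup X] [NormedSpace ℝ X]
    (Z : Type*) [NormedAddCommGroup Z] [NormedSpace ℝ Z]
    (m : ℕ) (V : Submodule ℝ X)
    (Q : X →L[ℝ] Z) (ℓ : Fin m → X →L[ℝ] ℝ)
    (ε η : ℝ) (hε : 0 < ε) (hη : 0 < η)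
    (p : ℝ≥0∞) [Fact (1 ≤ p)]
    -- the distance in X̃ = X × ℝ^m (with norm max{‖f‖_X, (ε/η)‖e‖_p}) to Ṽ = V × {0}
    (distT : X → PiLp p (fun _ : Fin m => ℝ) → ℝ)
    (hdistT : distT = fun f e => sInf {d : ℝ | ∃ v ∈ V,
      ∃ w ∈ ({0} : Set (PiLp p (fun _ : Fin m => ℝ))),
      d = max ‖f - v‖ (ε / η * ‖e - w‖)})
    -- the compatibility indicator μ_{Ṽ,Q̃}(L̃), with L̃(f,e) = L(f) + e and Q̃(f,e) = Q(f)
    (μ : ℝ)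
    (hμ : μ = sSup {c : ℝ | ∃ (f : X) (e : PiLp p (fun _ : Fin m => ℝ)),
      (∀ i, ℓ i f + WithLp.equiv p (Fin m → ℝ) e i = 0) ∧
      ¬(f ∈ V ∧ e = 0) ∧ c = ‖Q f‖ / distT f e}) :
    -- the formula for μ_{Ṽ,Q̃}(L̃) as a supremum over f ∈ X alone
    μ = sSup {c : ℝ | ∃ f : X,
      0 < max (Metric.infDist f (V : Set X))
          (ε / η * ‖(WithLp.equiv p (Fin m → ℝ)).symm (fun i => ℓ i f)‖) ∧
      c = ‖Q f‖ / max (Metric.infDist f (V : Set X))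
          (ε / η * ‖(WithLp.equiv p (Fin m → ℝ)).symm (fun i => ℓ i f)‖)} ∧
    -- and the comparison μ_{Ṽ,Q̃}(L̃) ≥ μ_{V,Q}(L)
    sSup {c : ℝ | ∃ f : X, (∀ i, ℓ i f = 0) ∧ f ∉ V ∧
      c = ‖Q f‖ / Metric.infDist f (V : Set X)} ≤ μ := by
  have hc : 0 < ε / η := div_pos hε hη
  let L : X →L[ℝ] PiLp p (fun _ : Fin m => ℝ) :=
    (PiLp.continuousLinearEquiv p ℝ (fun _ : Fin m => ℝ)).symm.toContinuousLinearMap ∘L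
      ContinuousLinearMap.pi ℓ
  have hL : ∀ f, (WithLp.equiv p (Fin m → ℝ)).symm (fun i => ℓ i f) = L f := fun f => rfl
  have hLi : ∀ f i, L f i = ℓ i f := fun f i => rfl
  have hker : ∀ f, (∀ i, ℓ i f = 0) ↔ L f = 0 := fun f =>
    ⟨fun h => by ext i; exact h i, fun h i => by rw [← hLi, h]; rfl⟩
  have haug : ∀ f (e : PiLp p (fun _ : Fin m => ℝ)),
      (∀ i, ℓ i f + WithLp.equiv p (Fin m → ℝ) e i = 0) ↔ e = -L f := fun f e =>
    ⟨fun h => by ext i; exact eq_neg_of_add_eq_zero_right (h i),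
      fun h i => by rw [h]; exact add_neg_cancel (ℓ i f)⟩
  have hdist : ∀ f e, distT f e = max (Metric.infDist f (V : Set X)) (ε / η * ‖e‖) :=
    fun f e => by rw [hdistT]; exact V.sInf_max_norm_sub_eq (ε / η) f e
  simp only [hL, hker]
  simp only [haug, hdist] at hμ
  have hformula : μ = sSup {c : ℝ | ∃ f : X,
      0 < max (Metric.infDist f (V : Set X)) (ε / η * ‖L f‖) ∧
      c = ‖Q f‖ / max (Metric.infDist f (V : Set X)) (ε / η * ‖L f‖)} := by
    rw [hμ]
    refine Real.sSup_eq_of_subset_of_subset_insert_zero ?_ ?_ ?_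
    · rintro _ ⟨f, hf, rfl⟩
      positivity
    · rintro _ ⟨f, hf, rfl⟩
      refine ⟨f, -L f, rfl, ?_, by rw [norm_neg]⟩
      rintro ⟨hfV, hLf⟩
      rw [neg_eq_zero] at hLf
      simp [hLf, Metric.infDist_zero_of_mem (show f ∈ (V : Set X) from hfV)] at hf
    · rintro _ ⟨f, e, rfl, -, rfl⟩
      rw [norm_neg]
      rcases (le_max_of_le_left Metric.infDist_nonneg :
        0 ≤ max (Metric.infDist f (V : Set X)) (ε / η * ‖L f‖)).eq_or_lt with h0 | hpos
      · left
        rw [← h0, div_zero]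
      · exact Or.inr ⟨f, hpos, rfl⟩
  exact ⟨hformula, hformula ▸ V.sSup_ratio_ker_le L Q hc⟩
end

section
/- Let X be a normed real vector space, V ⊆ X a linear subspace, ε > 0, p ∈ [1,∞] with conjugate exponent p′, η > 0, and let Q, ℓ_1,…,ℓ_m be continuous linear functionals on X with L(f) = (ℓ_1(f),…,ℓ_m(f)). If a ∈ ℝ^m satisfies Σ_{i=1}^m a_i ℓ_i(v) = Q(v) for all v ∈ V, then the worst-case error of the linear recovery map y ↦ Σ_{i=1}^m a_i y_i satisfies sup_{f ∈ K_{V,ε}, e ∈ E_{p,η}} |Q(f) − Σ_{i=1}^m a_i (ℓ_i(f) + e_i)| ≤ ε · ‖Q − Σ_{i=1}^m a_i ℓ_i‖_{X*} + η · ‖a‖_{p′}. -/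
open scoped ENNReal

namespace PiLp

variable {ι : Type*} [Fintype ι]

/-- Hölder's inequality for the exponents `∞` and `1`. -/
theorem sum_abs_mul_le_norm_top_mul_norm_one (x : PiLp ∞ fun _ : ι => ℝ)
    (y : PiLp 1 fun _ : ι => ℝ) : ∑ i, |x i * y i| ≤ ‖x‖ * ‖y‖ := by
  rw [norm_eq_of_L1, Finset.mul_sum]
  refine Finset.sum_le_sum fun i _ => ?_
  rw [abs_mul]
  exact mul_le_mul_of_nonneg_right (norm_apply_le x i) (abs_nonneg _)

/-- Hölder's inequality on `PiLp`, for conjugate exponents in `[1, ∞]`. -/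
theorem sum_abs_mul_le_norm_mul_norm {p q : ℝ≥0∞} [Fact (1 ≤ p)] [Fact (1 ≤ q)]
    (hpq : p⁻¹ + q⁻¹ = 1) (x : PiLp p fun _ : ι => ℝ) (y : PiLp q fun _ : ι => ℝ) :
    ∑ i, |x i * y i| ≤ ‖x‖ * ‖y‖ := by
  rcases eq_or_ne p ∞ with rfl | hp
  · obtain rfl : q = 1 := by simpa using hpq
    exact sum_abs_mul_le_norm_top_mul_norm_one x y
  rcases eq_or_ne q ∞ with rfl | hq
  · obtain rfl : p = 1 := by simpa using hpq
    simpa only [mul_comm] using sum_abs_mul_le_norm_top_mul_norm_one y x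
  have hp0 : 0 < p.toReal := ENNReal.toReal_pos (zero_lt_one.trans_le Fact.out).ne' hp
  have hq0 : 0 < q.toReal := ENNReal.toReal_pos (zero_lt_one.trans_le Fact.out).ne' hq
  have hconj : p.toReal.HolderConjugate q.toReal := by
    refine ⟨?_, hp0, hq0⟩
    have hp' : p⁻¹ ≠ ∞ := ENNReal.inv_ne_top.2 (zero_lt_one.trans_le Fact.out).ne'
    have hq' : q⁻¹ ≠ ∞ := ENNReal.inv_ne_top.2 (zero_lt_one.trans_le Fact.out).ne'
    simpa [ENNReal.toReal_add hp' hq'] using congrArg ENNReal.toReal hpq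
  rw [norm_eq_sum hp0, norm_eq_sum hq0]
  simpa [abs_mul] using
    Real.inner_le_Lp_mul_Lq Finset.univ (fun i => |x i|) (fun i => |y i|) hconj

end PiLp

/-- A functional vanishing on a subspace is controlled by the distance to that subspace. -/
theorem ContinuousLinearMap.norm_apply_le_norm_mul_infDist {X : Type*} [NormedAddCommGroup X]
    [NormedSpace ℝ X] (V : Submodule ℝ X) (R : X →L[ℝ] ℝ) (hR : ∀ v ∈ V, R v = 0) (f : X) :
    ‖R f‖ ≤ ‖R‖ * Metric.infDist f (V : Set X) := by
  have : Nonempty (V : Set X) := ⟨⟨0, V.zero_mem⟩⟩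
  rw [Metric.infDist_eq_iInf, Real.mul_iInf_of_nonneg (norm_nonneg R)]
  refine le_ciInf fun v => ?_
  have h := R.le_opNorm (f - v)
  rwa [map_sub, hR v v.2, sub_zero, ← dist_eq_norm] at h

/-- Worst-case error bound for a constraint-satisfying linear recovery map
over the approximability model set `K_{V,ε}` and the uncertainty set `E_{p,η}`. -/
theorem worst_case_error_bound_of_interpolating_weights
    (X : Type*) [NormedAddCommGroup X] [NormedSpace ℝ X]
    (m : ℕ) (V : Submodule ℝ X)
    (ε η : ℝ) (hε : 0 < ε) (hη : 0 < η)
    (p p' : ℝ≥0∞) [Fact (1 ≤ p)] [Fact (1 ≤ p')]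
    (hpp' : p⁻¹ + p'⁻¹ = 1)
    (Q : X →L[ℝ] ℝ) (ℓ : Fin m → X →L[ℝ] ℝ)
    (a : Fin m → ℝ)
    (hfeas : ∀ v ∈ V, ∑ i, a i * ℓ i v = Q v) :
    sSup {c : ℝ | ∃ (f : X) (e : PiLp p (fun _ : Fin m => ℝ)),
        Metric.infDist f (V : Set X) ≤ ε ∧ ‖e‖ ≤ η ∧
        c = |Q f - ∑ i, a i * (ℓ i f + WithLp.equiv p (Fin m → ℝ) e i)|}
      ≤ ε * ‖Q - ∑ i, a i • ℓ i‖ + η * ‖(WithLp.equiv p' (Fin m → ℝ)).symm a‖ := by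
  refine Real.sSup_le ?_ (by positivity)
  rintro _ ⟨f, e, hf, he, rfl⟩
  set R : X →L[ℝ] ℝ := Q - ∑ i, a i • ℓ i with hR
  set b := (WithLp.equiv p' (Fin m → ℝ)).symm a
  have hRapp (g : X) : R g = Q g - ∑ i, a i * ℓ i g := by simp [hR]
  have hmodel : |R f| ≤ ε * ‖R‖ := by
    have h := R.norm_apply_le_norm_mul_infDist V
      (fun v hv => by rw [hRapp, hfeas v hv, sub_self]) f
    rw [mul_comm]
    exact h.trans (mul_le_mul_of_nonneg_left hf (norm_nonneg R))
  have hnoise : |∑ i, e i * b i| ≤ η * ‖b‖ :=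
    (Finset.abs_sum_le_sum_abs _ _).trans <|
      (PiLp.sum_abs_mul_le_norm_mul_norm hpp' e b).trans <|
        mul_le_mul_of_nonneg_right he (norm_nonneg b)
  have hsplit : Q f - ∑ i, a i * (ℓ i f + WithLp.equiv p (Fin m → ℝ) e i)
      = R f - ∑ i, e i * b i := by
    rw [hRapp, sub_sub, ← Finset.sum_add_distrib]
    congr 1
    refine Finset.sum_congr rfl fun i _ => ?_
    rw [mul_add, mul_comm (e i)]
    rfl
  rw [hsplit]
  exact (abs_sub _ _).trans (add_le_add hmodel hnoise)
end

section
/- Let D be a compact Hausdorff space, X = C(D) with the supremum norm, V ⊆ C(D) a finite-dimensional subspace, ε > 0, p ∈ [1,∞] with conjugate exponent p′, η > 0, and let ℓ_1,…,ℓ_m be continuous linear functionals on C(D) with L(f) = (ℓ_1(f),…,ℓ_m(f)). Suppose Q_1,…,Q_n̄ are continuous linear functionals on C(D) with ‖Q_j‖_{C(D)*} ≤ 1 and u_1,…,u_n̄ ∈ C(D) satisfy Σ_{j=1}^{n̄} |u_j(x)| ≤ γ for all x ∈ D, for some γ ≥ 1, and that the operator P(f) = Σ_{j=1}^{n̄}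 Q_j(f) u_j satisfies P(v) = v for all v ∈ V. For each j, let a^{(j)} ∈ ℝ^m be a minimizer of ‖Q_j − Σ_{i=1}^m a_i ℓ_i‖_{C(D)*} + (η/ε)‖a‖_{p′} over all a ∈ ℝ^m with Σ_{i=1}^m a_i ℓ_i(v) = Q_j(v) for all v ∈ V, and define R^near : ℝ^m → C(D) by R^near(y) = Σ_{i=1}^m y_i a_i^near with a_i^near = Σ_{j=1}^{n̄} a_i^{(j)} u_j. If the compatibility indicator μ := μ_{Ṽ,Ĩ}(L̃) satisfies μ ≥ 1, then sup_{f ∈ K_{V,ε}, e ∈ E_{p,η}} ‖f − R^near(L(f)+e)‖_{C(D)} ≤ (1 + 2γ) · μ · ε. -/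
open scoped ENNReal

/-- Conjugate exponents in `[1, ∞]` are `(∞, 1)`, `(1, ∞)`, or conjugate finite exponents. -/
lemma ENNReal.HolderConjugate.trichotomy (p q : ℝ≥0∞) [ENNReal.HolderConjugate p q] :
    (p = ∞ ∧ q = 1) ∨ (p = 1 ∧ q = ∞) ∨
      (p ≠ ∞ ∧ q ≠ ∞ ∧ p.toReal.HolderConjugate q.toReal) := by
  have hpq : p⁻¹ + q⁻¹ = 1 := ENNReal.holderConjugate_iff.mp inferInstance
  by_cases hp : p = ∞
  · subst hp
    exact Or.inl ⟨rfl, by simpa using hpq⟩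
  by_cases hq : q = ∞
  · subst hq
    exact Or.inr (Or.inl ⟨by simpa using hpq, rfl⟩)
  exact Or.inr (Or.inr ⟨hp, hq, ENNReal.HolderConjugate.toReal_of_ne_top hp hq⟩)

namespace PiLp

variable {ι : Type*} [Fintype ι]

/-- Hölder's inequality for finite real sequences, endpoints included. -/
lemma sum_mul_le_norm_mul_norm (p q : ℝ≥0∞) [Fact (1 ≤ p)] [Fact (1 ≤ q)]
    [ENNReal.HolderConjugate p q] (x : PiLp p fun _ : ι ↦ ℝ) (y : PiLp q fun _ : ι ↦ ℝ) :
    ∑ i, x i * y i ≤ ‖x‖ * ‖y‖ := by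
  have habs : ∑ i, x i * y i ≤ ∑ i, ‖x i‖ * ‖y i‖ :=
    Finset.sum_le_sum fun i _ ↦ (le_abs_self _).trans (abs_mul _ _).le
  rcases ENNReal.HolderConjugate.trichotomy p q with ⟨rfl, rfl⟩ | ⟨rfl, rfl⟩ | ⟨hp, hq, hpq⟩
  · rw [PiLp.norm_eq_of_L1 y, Finset.mul_sum]
    refine habs.trans (Finset.sum_le_sum fun i _ ↦ ?_)
    gcongr
    exact PiLp.norm_apply_le x i
  · rw [PiLp.norm_eq_of_L1 x, Finset.sum_mul]
    refine habs.trans (Finset.sum_le_sum fun i _ ↦ ?_)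
    gcongr
    exact PiLp.norm_apply_le y i
  · rw [PiLp.norm_eq_sum hpq.pos, PiLp.norm_eq_sum hpq.symm.pos]
    exact Real.inner_le_Lp_mul_Lq Finset.univ x y hpq

/-- The `ℓ^q` norm of a finite real sequence is attained by pairing with some vector of the unit
ball of `ℓ^p`, for conjugate exponents `p` and `q`. -/
lemma exists_norm_le_one_sum_mul_eq_norm_s17 (p q : ℝ≥0∞) [Fact (1 ≤ p)] [Fact (1 ≤ q)]
    [ENNReal.HolderConjugate p q] (y : PiLp q fun _ : ι ↦ ℝ) :
    ∃ x : PiLp p fun _ : ι ↦ ℝ, ‖x‖ ≤ 1 ∧ ∑ i, y i * x i = ‖y‖ := by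
  classical
  have hsign (t : ℝ) : |(SignType.sign t : ℝ)| ≤ 1 := by
    rcases lt_trichotomy t 0 with h | h | h <;> simp [h]
  rcases ENNReal.HolderConjugate.trichotomy p q with ⟨rfl, rfl⟩ | ⟨rfl, rfl⟩ | ⟨hp, hq, hpq⟩
  · refine ⟨WithLp.toLp ∞ fun i ↦ (SignType.sign (y i) : ℝ), ?_, ?_⟩
    · rw [PiLp.norm_eq_ciSup]
      exact Real.iSup_le (fun i ↦ hsign _) zero_le_one
    · simp [PiLp.norm_eq_of_L1, self_mul_sign]
  · cases isEmpty_or_nonempty ι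
    · exact ⟨0, by simp, by simp [PiLp.norm_eq_ciSup]⟩
    obtain ⟨k, hk⟩ := exists_eq_ciSup_of_finite (f := fun i ↦ ‖y i‖)
    refine ⟨PiLp.single 1 k (SignType.sign (y k) : ℝ), ?_, ?_⟩
    · simpa using hsign (y k)
    · rw [PiLp.norm_eq_ciSup, ← hk]
      simp [PiLp.single_apply, self_mul_sign]
  · obtain ⟨g, hg, hgy⟩ := (NNReal.isGreatest_Lp Finset.univ (fun i ↦ ‖y i‖₊) hpq.symm).1
    refine ⟨WithLp.toLp p fun i ↦ (SignType.sign (y i) : ℝ) * g i, ?_, ?_⟩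
    · rw [PiLp.norm_eq_sum hpq.pos]
      refine Real.rpow_le_one (by positivity) ?_ (by have := hpq.pos; positivity)
      have hg' : ∑ i, (g i : ℝ) ^ p.toReal ≤ 1 := by exact_mod_cast hg
      refine (Finset.sum_le_sum fun i _ ↦ ?_).trans hg'
      refine Real.rpow_le_rpow (norm_nonneg _) ?_ hpq.pos.le
      simpa [abs_mul] using mul_le_of_le_one_left (g i).2 (hsign (y i))
    · rw [PiLp.norm_eq_sum hpq.symm.pos]
      have := congrArg ((↑) : NNReal → ℝ) hgy
      push_cast at this
      rw [← this]
      refine Finset.sum_congr rfl fun i _ ↦ ?_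
      simp [← mul_assoc, self_mul_sign]

end PiLp

/-- Duality for the regularized dual-norm program: if `Q` is bounded by `μ` times the distance to
`V × {0}` on the kernel of `(f, e) ↦ (ℓ i f + e i)ᵢ`, then some combination of the `ℓ i`
that agrees with `Q` on `V` has objective value at most `μ`. -/
lemma exists_weights_norm_sub_add_le {X ι : Type*} [SeminormedAddCommGroup X] [NormedSpace ℝ X]
    [Fintype ι] (V : Submodule ℝ X) (p q : ℝ≥0∞) [Fact (1 ≤ p)] [Fact (1 ≤ q)]
    [ENNReal.HolderConjugate p q] (ℓ : ι → X →L[ℝ] ℝ) (Q : X →L[ℝ] ℝ) {c μ : ℝ}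
    (hc : 0 < c) (hμ : 0 ≤ μ)
    (hker : ∀ (f : X) (e : PiLp p fun _ : ι ↦ ℝ), (∀ i, ℓ i f + e i = 0) →
      ∀ v ∈ V, Q f ≤ μ * max ‖f - v‖ (c * ‖e‖)) :
    ∃ a : ι → ℝ, (∀ v ∈ V, ∑ i, a i * ℓ i v = Q v) ∧
      ‖Q - ∑ i, a i • ℓ i‖ + c⁻¹ * ‖WithLp.toLp q a‖ ≤ μ := by
  classical
  let K : Submodule ℝ (X × PiLp p fun _ : ι ↦ ℝ) :=
    { carrier := {x | ∀ i, ℓ i x.1 + x.2 i = 0}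
      add_mem' := fun {x y} hx hy i ↦ by
        have := hx i
        have := hy i
        simp only [Prod.fst_add, Prod.snd_add, map_add, PiLp.add_apply]
        linarith
      zero_mem' := fun i ↦ by simp
      smul_mem' := fun t x hx i ↦ by
        have := hx i
        simp only [Prod.smul_fst, Prod.smul_snd, map_smul, PiLp.smul_apply, ← smul_add, this,
          smul_zero] }
  let N : (X × PiLp p fun _ : ι ↦ ℝ) → ℝ := fun x ↦ μ * max ‖V.mkQ x.1‖ (c * ‖x.2‖)
  obtain ⟨Λ, hΛK, hΛN⟩ := exists_extension_of_le_sublinear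
    ⟨K, (Q.toLinearMap ∘ₗ LinearMap.fst ℝ X (PiLp p fun _ : ι ↦ ℝ)).domRestrict K⟩ N
    (fun t ht x ↦ by
      simp only [N, Prod.smul_fst, Prod.smul_snd, map_smul, norm_smul, Real.norm_eq_abs,
        abs_of_pos ht, mul_left_comm c t, ← mul_max_of_nonneg _ _ ht.le]
      ring)
    (fun x y ↦ by
      simp only [N, ← mul_add]
      refine mul_le_mul_of_nonneg_left (max_le ?_ ?_) hμ
      · rw [Prod.fst_add, map_add]
        exact (norm_add_le _ _).trans (add_le_add (le_max_left _ _) (le_max_left _ _))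
      · refine (mul_le_mul_of_nonneg_left (norm_add_le x.2 y.2) hc.le).trans ?_
        rw [mul_add]
        exact add_le_add (le_max_right _ _) (le_max_right _ _))
    (fun ⟨⟨f, e⟩, hx⟩ ↦ by
      change Q f ≤ μ * max ‖V.mkQ f‖ (c * ‖e‖)
      refine le_of_forall_pos_le_add fun δ hδ ↦ ?_
      obtain ⟨z, hz, hzlt⟩ := Submodule.Quotient.norm_mk_lt (V.mkQ f) (ε := δ / (μ + 1))
        (by positivity)
      have hv : f - z ∈ V := (Submodule.Quotient.eq V).mp hz.symm
      have h := hker f e hx (f - z) hv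
      rw [sub_sub_cancel] at h
      have hδμ : μ * (δ / (μ + 1)) ≤ δ := by
        rw [← mul_div_assoc, div_le_iff₀ (by positivity)]
        nlinarith
      calc Q f ≤ μ * max ‖z‖ (c * ‖e‖) := h
        _ ≤ μ * (max ‖V.mkQ f‖ (c * ‖e‖) + δ / (μ + 1)) := by
          refine mul_le_mul_of_nonneg_left (max_le ?_ ?_) hμ
          · exact hzlt.le.trans (by gcongr; exact le_max_left _ _)
          · exact (le_max_right _ _).trans (le_add_of_nonneg_right (by positivity))
        _ ≤ μ * max ‖V.mkQ f‖ (c * ‖e‖) + δ := by rw [mul_add]; gcongr)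
  let a : ι → ℝ := fun i ↦ -Λ (0, PiLp.single p i 1)
  have hΛe (e : PiLp p fun _ : ι ↦ ℝ) : Λ (0, e) = -∑ i, a i * e i := by
    have he : ((0 : X), e) = ∑ i, e i • ((0 : X), PiLp.single p i (1 : ℝ)) := by
      refine Prod.ext (by simp [Prod.fst_sum]) ?_
      ext k
      simp [Prod.snd_sum, Pi.single_apply]
    rw [he, map_sum]
    simp only [map_smul, smul_eq_mul, a, mul_neg, Finset.sum_neg_distrib, neg_neg, mul_comm]
  have hΛf (f : X) : Λ (f, 0) = Q f - ∑ i, a i * ℓ i f := by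
    have hmem : (f, WithLp.toLp p fun i ↦ -ℓ i f) ∈ K := fun i ↦ by simp
    have h1 : Λ (f, WithLp.toLp p fun i ↦ -ℓ i f) = Q f := hΛK ⟨_, hmem⟩
    have h2 : (f, WithLp.toLp p fun i ↦ -ℓ i f) =
        (f, (0 : PiLp p fun _ : ι ↦ ℝ)) + (0, WithLp.toLp p fun i ↦ -ℓ i f) := by simp
    rw [h2, map_add, hΛe] at h1
    simp only [mul_neg, Finset.sum_neg_distrib, neg_neg] at h1
    linarith
  have hV (v : X) (hv : v ∈ V) : Λ (v, 0) ≤ 0 := by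
    have h := hΛN (v, 0)
    simpa [N, (Submodule.Quotient.mk_eq_zero V).mpr hv] using h
  obtain ⟨e, he1, hea⟩ := PiLp.exists_norm_le_one_sum_mul_eq_norm_s17 p q (WithLp.toLp q a)
  have hunit (f : X) (hf : ‖f‖ ≤ 1) :
      (Q - ∑ i, a i • ℓ i) f + c⁻¹ * ‖WithLp.toLp q a‖ ≤ μ := by
    have h1 : Λ (f, -c⁻¹ • e) = (Q - ∑ i, a i • ℓ i) f + c⁻¹ * ‖WithLp.toLp q a‖ := by
      have h2 : (f, -c⁻¹ • e) = (f, (0 : PiLp p fun _ : ι ↦ ℝ)) + (0, -c⁻¹ • e) := by simp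
      rw [h2, map_add, hΛe, hΛf, ← hea, Finset.mul_sum, ← Finset.sum_neg_distrib]
      simp [mul_left_comm]
    rw [← h1]
    refine (hΛN _).trans (mul_le_of_le_one_right hμ (max_le ?_ ?_))
    · exact (Submodule.Quotient.norm_mk_le V f).trans hf
    · simpa [norm_smul, abs_of_pos hc, hc.ne'] using he1
  refine ⟨a, fun v hv ↦ ?_, ?_⟩
  · have h1 := hV v hv
    have h2 := hV (-v) (V.neg_mem hv)
    rw [hΛf] at h1 h2
    simp only [map_neg, mul_neg, Finset.sum_neg_distrib] at h2
    linarith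
  · rw [← le_sub_iff_add_le]
    refine ContinuousLinearMap.opNorm_le_of_unit_norm ?_ fun f hf ↦ abs_le.mpr ⟨?_, ?_⟩
    · simpa using hunit 0 (by simp)
    · have := hunit (-f) (by simpa using hf.le)
      rw [map_neg] at this
      linarith
    · linarith [hunit f hf.le]

/-- A combination of functions with Lebesgue-type constant `γ` and coefficients bounded by `M` has
sup norm at most `M * γ`. -/
lemma ContinuousMap.norm_sum_smul_le {D ι : Type*} [TopologicalSpace D] [CompactSpace D]
    [Fintype ι] (u : ι → C(D, ℝ)) {γ M : ℝ} (hγ : 0 ≤ γ) (hM : 0 ≤ M)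
    (hu : ∀ x : D, ∑ j, |u j x| ≤ γ) (t : ι → ℝ) (ht : ∀ j, |t j| ≤ M) :
    ‖∑ j, t j • u j‖ ≤ M * γ := by
  refine (ContinuousMap.norm_le _ (mul_nonneg hM hγ)).mpr fun x ↦ ?_
  rw [ContinuousMap.sum_apply]
  calc ‖∑ j, (t j • u j) x‖ ≤ ∑ j, ‖(t j • u j) x‖ := norm_sum_le _ _
    _ ≤ ∑ j, M * |u j x| := Finset.sum_le_sum fun j _ ↦ by
      rw [ContinuousMap.smul_apply, norm_smul, Real.norm_eq_abs, Real.norm_eq_abs]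
      exact mul_le_mul_of_nonneg_right (ht j) (abs_nonneg _)
    _ ≤ M * γ := by
      rw [← Finset.mul_sum]
      exact mul_le_mul_of_nonneg_left (hu x) hM

/-- (Theorem 6.2 of the paper.) The linear map `R^near` built from a
quasi-interpolant `P(f) = Σ_j Q_j(f) u_j` and the optimal weights `a^{(j)}` is a near-optimal
recovery map for full approximation in `C(D)`: its worst-case error over `K_{V,ε}` and
`E_{p,η}` is at most `(1 + 2γ)·μ·ε`. -/
theorem near_optimal_full_recovery_in_CD
    (D : Type*) [TopologicalSpace D] [CompactSpace D] [T2Space D]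
    (m nbar : ℕ) (V : Submodule ℝ C(D, ℝ)) [FiniteDimensional ℝ V]
    (ε η : ℝ) (hε : 0 < ε) (hη : 0 < η)
    (p p' : ℝ≥0∞) [Fact (1 ≤ p)] [Fact (1 ≤ p')]
    (hpp' : p⁻¹ + p'⁻¹ = 1)
    (ℓ : Fin m → C(D, ℝ) →L[ℝ] ℝ)
    -- the quasi-interpolant data: functionals Q_j of dual norm ≤ 1 and functions u_j
    (Qf : Fin nbar → C(D, ℝ) →L[ℝ] ℝ) (hQ : ∀ j, ‖Qf j‖ ≤ 1)
    (u : Fin nbar → C(D, ℝ)) (γ : ℝ) (hγ : 1 ≤ γ)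
    (hu : ∀ x : D, ∑ j, |u j x| ≤ γ)
    -- the reproducing condition P(v) = v on V, where P(f) = Σ_j Q_j(f) u_j
    (hP : ∀ v ∈ V, ∑ j, Qf j v • u j = v)
    -- for each j, a^{(j)} minimizes the regularized dual-norm program with Q = Q_j
    (a : Fin nbar → Fin m → ℝ)
    (hfeas : ∀ j, ∀ v ∈ V, ∑ i, a j i * ℓ i v = Qf j v)
    (hmin : ∀ j, ∀ a' : Fin m → ℝ, (∀ v ∈ V, ∑ i, a' i * ℓ i v = Qf j v) →
      ‖Qf j - ∑ i, a j i • ℓ i‖ + η / ε * ‖(WithLp.equiv p' (Fin m → ℝ)).symm (a j)‖ ≤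
      ‖Qf j - ∑ i, a' i • ℓ i‖ + η / ε * ‖(WithLp.equiv p' (Fin m → ℝ)).symm a'‖)
    -- the distance in X̃ = C(D) × ℝ^m (norm max{‖f‖, (ε/η)‖e‖_p}) to Ṽ = V × {0}
    (distT : C(D, ℝ) → PiLp p (fun _ : Fin m => ℝ) → ℝ)
    (hdistT : distT = fun f e => sInf {d : ℝ | ∃ v ∈ V,
      ∃ w ∈ ({0} : Set (PiLp p (fun _ : Fin m => ℝ))),
      d = max ‖f - v‖ (ε / η * ‖e - w‖)})
    -- the compatibility indicator μ = μ_{Ṽ,Ĩ}(L̃) for full recovery, assumed ≥ 1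
    (μ : ℝ)
    (hμ : μ = sSup {c : ℝ | ∃ (f : C(D, ℝ)) (e : PiLp p (fun _ : Fin m => ℝ)),
      (∀ i, ℓ i f + WithLp.equiv p (Fin m → ℝ) e i = 0) ∧
      ¬(f ∈ V ∧ e = 0) ∧ c = ‖f‖ / distT f e})
    (hμ1 : 1 ≤ μ) :
    -- the worst-case error of R^near(y) = Σ_i y_i a_i^near, a_i^near = Σ_j a_i^{(j)} u_j
    sSup {c : ℝ | ∃ (f : C(D, ℝ)) (e : PiLp p (fun _ : Fin m => ℝ)),
        Metric.infDist f (V : Set C(D, ℝ)) ≤ ε ∧ ‖e‖ ≤ η ∧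
        c = ‖f - ∑ i, (ℓ i f + WithLp.equiv p (Fin m → ℝ) e i) • (∑ j, a j i • u j)‖}
      ≤ (1 + 2 * γ) * μ * ε := by
  have hconj : ENNReal.HolderConjugate p p' := ENNReal.holderConjugate_iff.mpr hpp'
  have hμ0 : 0 ≤ μ := zero_le_one.trans hμ1
  have hc : 0 < ε / η := div_pos hε hη
  have hdist_le (f : C(D, ℝ)) (e : PiLp p (fun _ : Fin m => ℝ)) (v : C(D, ℝ)) (hv : v ∈ V) :
      distT f e ≤ max ‖f - v‖ (ε / η * ‖e‖) := by
    rw [hdistT]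
    refine csInf_le ⟨0, ?_⟩ ⟨v, hv, 0, rfl, by rw [sub_zero]⟩
    rintro _ ⟨w, -, w', -, rfl⟩
    exact (norm_nonneg _).trans (le_max_left _ _)
  have hle_dist (f : C(D, ℝ)) (e : PiLp p (fun _ : Fin m => ℝ)) :
      max (Metric.infDist f (V : Set C(D, ℝ))) (ε / η * ‖e‖) ≤ distT f e := by
    rw [hdistT]
    refine le_csInf ⟨_, 0, V.zero_mem, 0, rfl, rfl⟩ ?_
    rintro _ ⟨v, hv, w, rfl, rfl⟩
    rw [sub_zero]
    refine max_le_max ?_ le_rfl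
    rw [← dist_eq_norm]
    exact Metric.infDist_le_dist_of_mem hv
  -- `1 ≤ μ` excludes the default value `0` of `sSup`, so `μ` is a genuine supremum
  have hbdd : BddAbove {c : ℝ | ∃ (f : C(D, ℝ)) (e : PiLp p (fun _ : Fin m => ℝ)),
      (∀ i, ℓ i f + WithLp.equiv p (Fin m → ℝ) e i = 0) ∧
      ¬(f ∈ V ∧ e = 0) ∧ c = ‖f‖ / distT f e} := by
    by_contra h
    rw [Real.sSup_of_not_bddAbove h] at hμ
    linarith
  have hker (f : C(D, ℝ)) (e : PiLp p (fun _ : Fin m => ℝ)) (hfe : ∀ i, ℓ i f + e i = 0) :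
      ‖f‖ ≤ μ * distT f e := by
    have hdist0 : 0 ≤ distT f e :=
      (Metric.infDist_nonneg.trans (le_max_left _ _)).trans (hle_dist f e)
    by_cases hV : f ∈ V ∧ e = 0
    · obtain ⟨hfV, rfl⟩ := hV
      have hℓ (i : Fin m) : ℓ i f = 0 := by simpa using hfe i
      have hf : f = 0 := by
        rw [← hP f hfV]
        exact Finset.sum_eq_zero fun j _ ↦ by simp [← hfeas j f hfV, hℓ]
      rw [hf, norm_zero]
      rw [hf] at hdist0
      exact mul_nonneg hμ0 hdist0
    · have hpos : 0 < distT f e := by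
        refine lt_of_lt_of_le ?_ (hle_dist f e)
        by_cases he : e = 0
        · have hfV : f ∉ (V : Set C(D, ℝ)) := fun h ↦ hV ⟨h, he⟩
          exact lt_max_of_lt_left
            ((V.closed_of_finiteDimensional.notMem_iff_infDist_pos ⟨0, V.zero_mem⟩).mp hfV)
        · exact lt_max_of_lt_right (mul_pos hc (norm_pos_iff.mpr he))
      rw [← div_le_iff₀ hpos, hμ]
      exact le_csSup hbdd ⟨f, e, hfe, hV, rfl⟩
  have hweights (j : Fin nbar) :
      ‖Qf j - ∑ i, a j i • ℓ i‖ + η / ε * ‖WithLp.toLp p' (a j)‖ ≤ μ := by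
    obtain ⟨a', ha'feas, ha'⟩ := exists_weights_norm_sub_add_le V p p' ℓ (Qf j) hc hμ0
      fun f e hfe v hv ↦ calc
        Qf j f ≤ ‖Qf j f‖ := le_abs_self _
        _ ≤ ‖f‖ := by simpa using (Qf j).le_of_opNorm_le (hQ j) f
        _ ≤ μ * distT f e := hker f e hfe
        _ ≤ μ * max ‖f - v‖ (ε / η * ‖e‖) :=
          mul_le_mul_of_nonneg_left (hdist_le f e v hv) hμ0
    rw [inv_div] at ha'
    exact (hmin j a' ha'feas).trans ha'
  refine Real.sSup_le ?_ (by positivity)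
  rintro _ ⟨f, e, hf, he, rfl⟩
  refine le_of_forall_gt_imp_ge_of_dense fun b hb ↦ ?_
  have hC : 0 < (1 + 2 * γ) * μ := by positivity
  obtain ⟨r, hr, rfl⟩ : ∃ r, ε < r ∧ (1 + 2 * γ) * μ * r = b :=
    ⟨b / ((1 + 2 * γ) * μ), by rwa [lt_div_iff₀' hC], mul_div_cancel₀ _ hC.ne'⟩
  obtain ⟨v, hv, hfv⟩ := (Metric.infDist_lt_iff (s := (V : Set C(D, ℝ))) ⟨0, V.zero_mem⟩).mp
    (hf.trans_lt hr)
  rw [dist_eq_norm] at hfv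
  have hr0 : 0 < r := hε.trans hr
  have herr : f - ∑ i, (ℓ i f + e i) • (∑ j, a j i • u j) =
      (f - v) - ∑ j, (∑ i, a j i * (ℓ i f + e i) - Qf j v) • u j := by
    simp only [sub_smul, Finset.sum_sub_distrib, hP v hv, Finset.smul_sum, Finset.sum_smul]
    rw [Finset.sum_comm]
    simp only [smul_smul, mul_comm]
    abel
  have hcoeff (j : Fin nbar) : |∑ i, a j i * (ℓ i f + e i) - Qf j v| ≤ (1 + μ) * r := by
    have hsplit : ∑ i, a j i * (ℓ i f + e i) - Qf j v =
        Qf j (f - v) - (Qf j - ∑ i, a j i • ℓ i) (f - v) + ∑ i, a j i * e i := by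
      simp [mul_add, mul_sub, Finset.sum_add_distrib, ← hfeas j v hv]
      ring
    have hQz : |Qf j (f - v)| ≤ r := by
      have := (Qf j).le_of_opNorm_le (hQ j) (f - v)
      rw [Real.norm_eq_abs] at this
      linarith
    have hRz : |(Qf j - ∑ i, a j i • ℓ i) (f - v)| ≤ ‖Qf j - ∑ i, a j i • ℓ i‖ * r :=
      ((Qf j - ∑ i, a j i • ℓ i).le_opNorm (f - v)).trans (by gcongr)
    have hae : |∑ i, a j i * e i| ≤ η / ε * ‖WithLp.toLp p' (a j)‖ * r := by
      have hbound : ‖e‖ * ‖WithLp.toLp p' (a j)‖ ≤ η / ε * ‖WithLp.toLp p' (a j)‖ * r := calc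
        _ ≤ η / ε * ε * ‖WithLp.toLp p' (a j)‖ := by
          rw [div_mul_cancel₀ _ hε.ne']
          gcongr
        _ ≤ η / ε * r * ‖WithLp.toLp p' (a j)‖ := by gcongr
        _ = _ := by ring
      have h1 := PiLp.sum_mul_le_norm_mul_norm p p' e (WithLp.toLp p' (a j))
      have h2 := PiLp.sum_mul_le_norm_mul_norm p p' (-e) (WithLp.toLp p' (a j))
      simp only [PiLp.neg_apply, neg_mul, Finset.sum_neg_distrib, norm_neg, mul_comm (e _)] at h1 h2
      exact abs_le.mpr ⟨by linarith, by linarith⟩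
    have hw := mul_le_mul_of_nonneg_right (hweights j) hr0.le
    rw [hsplit]
    have h1 := abs_add_le (Qf j (f - v) - (Qf j - ∑ i, a j i • ℓ i) (f - v)) (∑ i, a j i * e i)
    have h2 := abs_sub (Qf j (f - v)) ((Qf j - ∑ i, a j i • ℓ i) (f - v))
    linarith
  have hγ0 : 0 ≤ γ := zero_le_one.trans hγ
  calc ‖f - ∑ i, (ℓ i f + e i) • (∑ j, a j i • u j)‖
      ≤ ‖f - v‖ + ‖∑ j, (∑ i, a j i * (ℓ i f + e i) - Qf j v) • u j‖ := by
        rw [herr]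
        exact norm_sub_le _ _
    _ ≤ r + (1 + μ) * r * γ := add_le_add hfv.le
        (ContinuousMap.norm_sum_smul_le u hγ0 (by positivity) hu _ hcoeff)
    _ ≤ (1 + 2 * γ) * μ * r := by
        nlinarith [mul_nonneg (sub_nonneg.mpr hμ1) hr0.le,
          mul_nonneg (mul_nonneg (sub_nonneg.mpr hμ1) hr0.le) hγ0]
end

section
/- Let ν be a finite nonnegative Borel measure on [−1,1] and let N ≥ 1. Then the symmetric Toeplitz matrix Toep_N(z) built from the vector z ∈ ℝ^N of Chebyshev moments z_k = ∫_{−1}^{1} T_{k−1}(x) dν(x), k ∈ [1:N], is positive semidefinite, where T_j denotes the j-th Chebyshev polynomial of the first kind. -/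
open MeasureTheory Polynomial

/-- On `[-1,1]`, `T_{|j-k|}(x) = cos (j θ) cos (k θ) + sin (j θ) sin (k θ)` with `θ = arccos x`. -/
theorem chebyshev_T_dist_eval (j k : ℕ) {x : ℝ} (hx : x ∈ Set.Icc (-1 : ℝ) 1) :
    (Polynomial.Chebyshev.T ℝ (Nat.dist j k : ℤ)).eval x =
      Real.cos (j * Real.arccos x) * Real.cos (k * Real.arccos x) +
        Real.sin (j * Real.arccos x) * Real.sin (k * Real.arccos x) := by
  have hT : Polynomial.Chebyshev.T ℝ (Nat.dist j k : ℤ) =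
      Polynomial.Chebyshev.T ℝ ((j : ℤ) - k) := by
    rcases le_total j k with h | h
    · rw [Nat.dist_eq_sub_of_le h, ← Polynomial.Chebyshev.T_neg, Nat.cast_sub h, neg_sub]
    · rw [Nat.dist_eq_sub_of_le_right h, Nat.cast_sub h]
  conv_lhs => rw [hT, ← Real.cos_arccos hx.1 hx.2, Polynomial.Chebyshev.T_real_cos]
  rw [← Real.cos_sub]
  push_cast
  ring_nf

/-- The Toeplitz quadratic form of the Chebyshev values at a point of `[-1,1]` is nonnegative. -/
theorem sum_mul_chebyshev_T_dist_eval_nonneg {N : ℕ} (v : Fin N → ℝ) {x : ℝ}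
    (hx : x ∈ Set.Icc (-1 : ℝ) 1) :
    0 ≤ ∑ j : Fin N, ∑ k : Fin N,
      v j * ((Polynomial.Chebyshev.T ℝ (Nat.dist j.1 k.1 : ℤ)).eval x * v k) := by
  have h : ∑ j : Fin N, ∑ k : Fin N,
      v j * ((Polynomial.Chebyshev.T ℝ (Nat.dist j.1 k.1 : ℤ)).eval x * v k) =
      (∑ j : Fin N, v j * Real.cos (j * Real.arccos x)) ^ 2 +
        (∑ j : Fin N, v j * Real.sin (j * Real.arccos x)) ^ 2 := by
    simp_rw [sq, Finset.sum_mul_sum, ← Finset.sum_add_distrib, chebyshev_T_dist_eval _ _ hx]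
    refine Finset.sum_congr rfl fun j _ => Finset.sum_congr rfl fun k _ => ?_
    ring
  rw [h]
  positivity

/-- The symmetric Toeplitz matrix built from the Chebyshev moments of a
finite nonnegative Borel measure on `[-1,1]` is positive semidefinite. -/
theorem toeplitz_of_chebyshev_moments_posSemidef
    (N : ℕ) (hN : 1 ≤ N)
    (ν : Measure (Set.Icc (-1 : ℝ) 1)) [IsFiniteMeasure ν]
    (z : Fin N → ℝ)
    (hz : z = fun (k : Fin N) => ∫ x, (Polynomial.Chebyshev.T ℝ (k.1 : ℤ)).eval (x : ℝ) ∂ν) :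
    (Toep z).PosSemidef := by
  have hint (n : ℤ) : Integrable
      (fun x : Set.Icc (-1 : ℝ) 1 => (Polynomial.Chebyshev.T ℝ n).eval (x : ℝ)) ν :=
    Continuous.integrable_of_hasCompactSupport (by fun_prop) (HasCompactSupport.of_compactSpace _)
  refine Matrix.PosSemidef.of_dotProduct_mulVec_nonneg ?_ fun v => ?_
  · ext j k
    simp [Toep, Nat.dist_comm]
  · have h : star v ⬝ᵥ (Toep z).mulVec v = ∫ x : Set.Icc (-1 : ℝ) 1, ∑ j : Fin N, ∑ k : Fin N,
        v j * ((Polynomial.Chebyshev.T ℝ (Nat.dist j.1 k.1 : ℤ)).eval (x : ℝ) * v k) ∂ν := by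
      rw [integral_finsetSum _ fun j _ => integrable_finsetSum _ fun k _ =>
        ((hint _).mul_const _).const_mul _]
      simp_rw [integral_finsetSum _ fun k _ => ((hint _).mul_const _).const_mul _,
        integral_const_mul, integral_mul_const]
      simp [Toep, hz, dotProduct, Matrix.mulVec, Finset.mul_sum]
    rw [h]
    exact integral_nonneg fun x => sum_mul_chebyshev_T_dist_eval_nonneg v x.2
end
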